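/- For every f ∈ C(X_1,ℝ), the a-weighted topological pressure satisfies the lower bound P^a(T_1, f) ≥ sup_{μ ∈ M(X_1,T_1)} ( Σ_{i=1}^k a_i h_{τ_{i−1}μ}(T_i) + ∫ f dμ ). -/

import Mathlib

open MeasureTheory Set Filter Topology
open scoped ENNReal symmDiff

namespace WTP

variable {k : ℕ}

/-- cumulative weight `a 1 + … + a i` (zero-indexed: `a 0 + … + a i`). -/
noncomputable def cw (a : Fin k → ℝ) (i : Fin k) : ℝ := ∑ j ∈ Finset.Iic i, a j

/-- Birkhoff sum `S_n f = ∑_{l<n} f ∘ T^l`. -/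
noncomputable def birk {X : Type*} (T : X → X) (f : X → ℝ) (n : ℕ) (x : X) : ℝ :=
  ∑ l ∈ Finset.range n, f (T^[l] x)

/-- a (finite) open cover of a topological space. -/
def IsOpenCover {X : Type*} [TopologicalSpace X] (𝒰 : Set (Set X)) : Prop :=
  𝒰.Finite ∧ (∀ U ∈ 𝒰, IsOpen U) ∧ ⋃₀ 𝒰 = Set.univ

/-- pullback of a cover along a map. -/
def pullCov {X Y : Type*} (g : X → Y) (𝒰 : Set (Set Y)) : Set (Set X) :=
  (fun U => g ⁻¹' U) '' 𝒰

/-- the quantity `exp(−s·n + (1/a₁)·sup_{x∈A} S_{⌈a₁ n⌉} f(x))`, as an element of `ℝ≥0∞`. -/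
noncomputable def pterm {X : Type*} (T1 : X → X) (f : X → ℝ) (a1 s : ℝ) (n : ℕ)
    (A : Set X) : ℝ≥0∞ :=
  ENNReal.ofReal (Real.exp (-(s * n) + (1 / a1) * sSup (birk T1 f ⌈a1 * (n : ℝ)⌉₊ '' A)))

/-- the weighted Bowen ball `B_n^𝐚(x, ε)`. -/
def wBowen {X : Fin k → Type*} [∀ i, MetricSpace (X i)] {X1 : Type*}
    (T : ∀ i, X i → X i) (τ : ∀ i, X1 → X i) (a : Fin k → ℝ)
    (n : ℕ) (x : X1) (ε : ℝ) : Set X1 :=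
  {y | ∀ i : Fin k, ∀ j < ⌈cw a i * (n : ℝ)⌉₊,
      dist ((T i)^[j] (τ i x)) ((T i)^[j] (τ i y)) < ε}

section Bowen

variable [NeZero k] {X : Fin k → Type*} [∀ i, MetricSpace (X i)] {X1 : Type*}
  [MeasurableSpace X1]

/-- `Λ^{𝐚,s}_{N,ε}(Z,f)`. -/
noncomputable def lamBowenN (T1 : X1 → X1) (T : ∀ i, X i → X i) (τ : ∀ i, X1 → X i)
    (a : Fin k → ℝ) (f : X1 → ℝ) (s ε : ℝ) (N : ℕ) (Z : Set X1) : ℝ≥0∞ :=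
  ⨅ (D : Set (ℕ × Set X1)) (_ : D.Countable)
    (_ : ∀ p ∈ D, N ≤ p.1 ∧ MeasurableSet p.2 ∧ ∃ x : X1, p.2 ⊆ wBowen T τ a p.1 x ε)
    (_ : Z ⊆ ⋃ p ∈ D, p.2),
    ∑' p : D, pterm T1 f (a 0) s p.1.1 p.1.2

/-- `Λ^{𝐚,s}_{ε}(Z,f) = lim_{N→∞} Λ^{𝐚,s}_{N,ε}(Z,f)` (an increasing limit). -/
noncomputable def lamBowen (T1 : X1 → X1) (T : ∀ i, X i → X i) (τ : ∀ i, X1 → X i)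
    (a : Fin k → ℝ) (f : X1 → ℝ) (s ε : ℝ) (Z : Set X1) : ℝ≥0∞ :=
  ⨆ N : ℕ, lamBowenN T1 T τ a f s ε N Z

/-- `P^𝐚(T₁, Z, ε, f) = inf {s : Λ^{𝐚,s}_ε(Z,f) = 0}`. -/
noncomputable def PBowenEps (T1 : X1 → X1) (T : ∀ i, X i → X i) (τ : ∀ i, X1 → X i)
    (a : Fin k → ℝ) (Z : Set X1) (f : X1 → ℝ) (ε : ℝ) : EReal :=
  sInf (Real.toEReal '' {s : ℝ | lamBowen T1 T τ a f s ε Z = 0})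

/-- the 𝐚-weighted topological pressure `P^𝐚(T₁, Z, f) = lim_{ε→0} P^𝐚(T₁, Z, ε, f)`
(an increasing limit as `ε` decreases to `0`). -/
noncomputable def PBowen (T1 : X1 → X1) (T : ∀ i, X i → X i) (τ : ∀ i, X1 → X i)
    (a : Fin k → ℝ) (Z : Set X1) (f : X1 → ℝ) : EReal :=
  ⨆ ε : {e : ℝ // 0 < e}, PBowenEps T1 T τ a Z f ε.1

/-- `W^{𝐚,s}_{N,ε}(Z,f)`. -/
noncomputable def wBowenWN (T1 : X1 → X1) (T : ∀ i, X i → X i) (τ : ∀ i, X1 → X i)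
    (a : Fin k → ℝ) (f : X1 → ℝ) (s ε : ℝ) (N : ℕ) (Z : Set X1) : ℝ≥0∞ :=
  ⨅ (D : Set (ℕ × Set X1 × ℝ≥0∞)) (_ : D.Countable)
    (_ : ∀ p ∈ D, N ≤ p.1 ∧ MeasurableSet p.2.1 ∧ 0 < p.2.2 ∧ p.2.2 ≠ ⊤ ∧
        ∃ x : X1, p.2.1 ⊆ wBowen T τ a p.1 x ε)
    (_ : ∀ z ∈ Z, 1 ≤ ∑' p : D, (p.1.2.1).indicator (fun _ => p.1.2.2) z),
    ∑' p : D, p.1.2.2 * pterm T1 f (a 0) s p.1.1 p.1.2.1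

/-- `W^{𝐚,s}_{ε}(Z,f)`. -/
noncomputable def wBowenW (T1 : X1 → X1) (T : ∀ i, X i → X i) (τ : ∀ i, X1 → X i)
    (a : Fin k → ℝ) (f : X1 → ℝ) (s ε : ℝ) (Z : Set X1) : ℝ≥0∞ :=
  ⨆ N : ℕ, wBowenWN T1 T τ a f s ε N Z

/-- `P_W^𝐚(T₁, Z, ε, f)`. -/
noncomputable def PWBowenEps (T1 : X1 → X1) (T : ∀ i, X i → X i) (τ : ∀ i, X1 → X i)
    (a : Fin k → ℝ) (Z : Set X1) (f : X1 → ℝ) (ε : ℝ) : EReal :=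
  sInf (Real.toEReal '' {s : ℝ | wBowenW T1 T τ a f s ε Z = 0})

/-- the average 𝐚-weighted topological pressure `P_W^𝐚(T₁, Z, f)`. -/
noncomputable def PWBowen (T1 : X1 → X1) (T : ∀ i, X i → X i) (τ : ∀ i, X1 → X i)
    (a : Fin k → ℝ) (Z : Set X1) (f : X1 → ℝ) : EReal :=
  ⨆ ε : {e : ℝ // 0 < e}, PWBowenEps T1 T τ a Z f ε.1

end Bowen

section Local

variable [NeZero k] {X1 : Type*} [MeasurableSpace X1]

/-- the cover `⋁_{i=1}^k (τ_{i-1}^{-1} 𝒰_i)_0^{⌈(a_1+…+a_i) n⌉ - 1}` on the first space, where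
`𝒱 i` is the pulled back cover `τ_{i-1}^{-1} 𝒰_i`. -/
def jointFiber (T1 : X1 → X1) (a : Fin k → ℝ) (𝒱 : Fin k → Set (Set X1)) (n : ℕ) :
    Set (Set X1) :=
  {A | ∃ V : Fin k → ℕ → Set X1,
      (∀ i, ∀ l < ⌈cw a i * (n : ℝ)⌉₊, V i l ∈ 𝒱 i) ∧
      A = ⋂ i : Fin k, ⋂ l ∈ Finset.range ⌈cw a i * (n : ℝ)⌉₊, (T1^[l]) ⁻¹' V i l}

/-- `Λ^{𝐚,s}_{N,{𝒰_i}}(Z,f)`. -/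
noncomputable def lamLocN (T1 : X1 → X1) (a : Fin k → ℝ) (𝒱 : Fin k → Set (Set X1))
    (f : X1 → ℝ) (s : ℝ) (N : ℕ) (Z : Set X1) : ℝ≥0∞ :=
  ⨅ (D : Set (ℕ × Set X1)) (_ : D.Countable)
    (_ : ∀ p ∈ D, N ≤ p.1 ∧ MeasurableSet p.2 ∧ ∃ A ∈ jointFiber T1 a 𝒱 p.1, p.2 ⊆ A)
    (_ : Z ⊆ ⋃ p ∈ D, p.2),
    ∑' p : D, pterm T1 f (a 0) s p.1.1 p.1.2

/-- `Λ^{𝐚,s}_{{𝒰_i}}(Z,f)`. -/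
noncomputable def lamLoc (T1 : X1 → X1) (a : Fin k → ℝ) (𝒱 : Fin k → Set (Set X1))
    (f : X1 → ℝ) (s : ℝ) (Z : Set X1) : ℝ≥0∞ :=
  ⨆ N : ℕ, lamLocN T1 a 𝒱 f s N Z

/-- the local 𝐚-weighted topological pressure `P^𝐚(T₁, Z, {𝒰_i}, f)`, expressed through the
pulled-back covers `𝒱 i = τ_{i-1}^{-1} 𝒰_i`. -/
noncomputable def PLoc (T1 : X1 → X1) (a : Fin k → ℝ) (𝒱 : Fin k → Set (Set X1))
    (Z : Set X1) (f : X1 → ℝ) : EReal :=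
  sInf (Real.toEReal '' {s : ℝ | lamLoc T1 a 𝒱 f s Z = 0})

/-- `W^{𝐚,s}_{N,{𝒰_i}}(Z,f)`. -/
noncomputable def wLocN (T1 : X1 → X1) (a : Fin k → ℝ) (𝒱 : Fin k → Set (Set X1))
    (f : X1 → ℝ) (s : ℝ) (N : ℕ) (Z : Set X1) : ℝ≥0∞ :=
  ⨅ (D : Set (ℕ × Set X1 × ℝ≥0∞)) (_ : D.Countable)
    (_ : ∀ p ∈ D, N ≤ p.1 ∧ MeasurableSet p.2.1 ∧ 0 < p.2.2 ∧ p.2.2 ≠ ⊤ ∧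
        ∃ A ∈ jointFiber T1 a 𝒱 p.1, p.2.1 ⊆ A)
    (_ : ∀ z ∈ Z, 1 ≤ ∑' p : D, (p.1.2.1).indicator (fun _ => p.1.2.2) z),
    ∑' p : D, p.1.2.2 * pterm T1 f (a 0) s p.1.1 p.1.2.1

/-- `W^{𝐚,s}_{{𝒰_i}}(Z,f)`. -/
noncomputable def wLoc (T1 : X1 → X1) (a : Fin k → ℝ) (𝒱 : Fin k → Set (Set X1))
    (f : X1 → ℝ) (s : ℝ) (Z : Set X1) : ℝ≥0∞ :=
  ⨆ N : ℕ, wLocN T1 a 𝒱 f s N Z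

/-- the local average 𝐚-weighted topological pressure `P_W^𝐚(T₁, Z, {𝒰_i}, f)`. -/
noncomputable def PWLoc (T1 : X1 → X1) (a : Fin k → ℝ) (𝒱 : Fin k → Set (Set X1))
    (Z : Set X1) (f : X1 → ℝ) : EReal :=
  sInf (Real.toEReal '' {s : ℝ | wLoc T1 a 𝒱 f s Z = 0})

end Local

/-- iterated join `(𝒰)_0^{n-1} = ⋁_{l=0}^{n-1} T^{-l} 𝒰` of a cover. -/
def covJoinT {X : Type*} (T : X → X) (𝒰 : Set (Set X)) (n : ℕ) : Set (Set X) :=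
  {A | ∃ u : ℕ → Set X, (∀ l < n, u l ∈ 𝒰) ∧
      A = ⋂ l ∈ Finset.range n, (T^[l]) ⁻¹' u l}

/-- the join `⋁_{j=i}^{k} 𝒱 j` of covers of a single space (in applications
`𝒱 j = τ_{j-1}^{-1} 𝒰_j`). -/
def joinFrom {X1 : Type*} (𝒱 : Fin k → Set (Set X1)) (i : Fin k) : Set (Set X1) :=
  {A | ∃ V : Fin k → Set X1, (∀ j, i ≤ j → V j ∈ 𝒱 j) ∧ A = ⋂ j ∈ Finset.Ici i, V j}

/-- a finite measurable partition (indexed). -/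
def IsPart {X : Type*} [MeasurableSpace X] {ι : Type*} (β : ι → Set X) : Prop :=
  (∀ i, MeasurableSet (β i)) ∧ (∀ i j, i ≠ j → Disjoint (β i) (β j)) ∧ ⋃ i, β i = Set.univ

/-- the static entropy `H_μ(β) = -∑ μ(B) log μ(B)` of a finite (indexed) partition. -/
noncomputable def entH {X : Type*} [MeasurableSpace X] {ι : Type*} [Fintype ι]
    (μ : Measure X) (β : ι → Set X) : ℝ :=
  ∑ i, Real.negMulLog (μ (β i)).toReal

/-- the dynamical join `⋁_{l=0}^{n-1} T^{-l} β` of a partition. -/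
def dynJoin {X : Type*} (T : X → X) {ι : Type*} (β : ι → Set X) (n : ℕ) :
    (Fin n → ι) → Set X :=
  fun c => ⋂ l : Fin n, (T^[(l : ℕ)]) ⁻¹' β (c l)

/-- the measure-theoretic entropy `h_μ(T, β) = lim_n (1/n) H_μ(⋁_{l<n} T^{-l}β)` of `T`
relative to a finite partition. -/
noncomputable def hPart {X : Type*} [MeasurableSpace X] {ι : Type*} [Fintype ι]
    (μ : Measure X) (T : X → X) (β : ι → Set X) : EReal :=
  Filter.liminf (fun n : ℕ => ((entH μ (dynJoin T β n) / n : ℝ) : EReal)) Filter.atTop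

/-- the Kolmogorov–Sinai entropy `h_μ(T)`. -/
noncomputable def hKS {X : Type*} [MeasurableSpace X] (μ : Measure X) (T : X → X) : EReal :=
  ⨆ p : (Σ m : ℕ, {β : Fin m → Set X // IsPart β}), hPart μ T p.2.1

/-- `H_μ(𝒰) = inf {H_μ(β) : β a finite measurable partition refining 𝒰}`. -/
noncomputable def covH {X : Type*} [MeasurableSpace X] (μ : Measure X)
    (𝒰 : Set (Set X)) : ℝ :=
  sInf {h : ℝ | ∃ (m : ℕ) (β : Fin m → Set X), IsPart β ∧
      (∀ i, ∃ U ∈ 𝒰, β i ⊆ U) ∧ h = entH μ β}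

/-- the local measure-theoretic entropy `h_μ(T, 𝒰) = lim_n (1/n) H_μ((𝒰)_0^{n-1})` of `T`
relative to an open cover. -/
noncomputable def hCov {X : Type*} [MeasurableSpace X] (μ : Measure X) (T : X → X)
    (𝒰 : Set (Set X)) : EReal :=
  Filter.liminf (fun n : ℕ => ((covH μ (covJoinT T 𝒰 n) / n : ℝ) : EReal)) Filter.atTop

/-- `h⁺_μ(T,𝒰) = inf {h_μ(T,β) : β a finite measurable partition refining 𝒰}`. -/
noncomputable def hCovPlus {X : Type*} [MeasurableSpace X] (μ : Measure X) (T : X → X)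
    (𝒰 : Set (Set X)) : EReal :=
  ⨅ p : (Σ m : ℕ, {β : Fin m → Set X // IsPart β ∧ ∀ i, ∃ U ∈ 𝒰, β i ⊆ U}),
    hPart μ T p.2.1

/-- the join `⋁_{j=i}^{k} γ j` of partitions of a single space (in applications
`γ j = τ_{j-1}^{-1} α_j`). -/
def partJoinFrom {X1 : Type*} {ι : Fin k → Type*} (γ : ∀ j, ι j → Set X1) (i : Fin k) :
    (∀ j : {j : Fin k // i ≤ j}, ι j) → Set X1 :=
  fun c => ⋂ j : {j : Fin k // i ≤ j}, γ j (c j)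

/-- the partition `⋁_{i=1}^k (γ_i)_0^{⌈(a_1+…+a_i)N⌉-1}` on the first space, where
`γ i = τ_{i-1}^{-1} α_i`. -/
def bigPartJoin {X1 : Type*} (T1 : X1 → X1) (a : Fin k → ℝ) {ι : Fin k → Type*}
    (γ : ∀ i, ι i → Set X1) (N : ℕ) :
    (∀ i : Fin k, Fin ⌈cw a i * (N : ℝ)⌉₊ → ι i) → Set X1 :=
  fun c => ⋂ i : Fin k, ⋂ l : Fin ⌈cw a i * (N : ℝ)⌉₊, (T1^[(l : ℕ)]) ⁻¹' γ i (c i l)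

/-- conditional entropy `H_μ(γ|β) = H_μ(γ ∨ β) - H_μ(β)`. -/
noncomputable def condEnt {X : Type*} [MeasurableSpace X] {ι κ : Type*} [Fintype ι] [Fintype κ]
    (μ : Measure X) (γ : ι → Set X) (β : κ → Set X) : ℝ :=
  entH μ (fun p : ι × κ => γ p.1 ∩ β p.2) - entH μ β

/-- the oscillation `w_f(⋁_{i=1}^k τ_{i-1}^{-1} 𝒰_i)` of `f` on the joined cover, where
`𝒱 i = τ_{i-1}^{-1} 𝒰_i`. -/
noncomputable def wfJoin {X1 : Type*} (f : X1 → ℝ) (𝒱 : Fin k → Set (Set X1)) : ℝ :=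
  sSup {d : ℝ | ∃ V : Fin k → Set X1, (∀ i, V i ∈ 𝒱 i) ∧
      ∃ x ∈ ⋂ i, V i, ∃ y ∈ ⋂ i, V i, d = |f x - f y|}

/-- the topological support of a measure. -/
def msupp {X : Type*} [TopologicalSpace X] [MeasurableSpace X] (μ : Measure X) : Set X :=
  {x | ∀ U : Set X, IsOpen U → x ∈ U → 0 < μ U}

section Birkhoff

lemma measurable_birkhoffSum {X : Type*} [MeasurableSpace X] {T : X → X} (hT : Measurable T)
    {φ : X → ℝ} (hφ : Measurable φ)
    (n : ℕ) : Measurable (birkhoffSum T φ n) := by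
  unfold birkhoffSum
  exact Finset.measurable_sum _ fun i _ => hφ.comp (hT.iterate i)

lemma birkhoffSum_mem_Icc {X : Type*} {T : X → X} {φ : X → ℝ} {C : ℝ} (h0 : ∀ x, 0 ≤ φ x)
    (hC : ∀ x, φ x ≤ C) (n : ℕ) (x : X) :
    0 ≤ birkhoffSum T φ n x ∧ birkhoffSum T φ n x ≤ n * C := by
  constructor
  · exact Finset.sum_nonneg fun i _ => h0 _
  · calc birkhoffSum T φ n x ≤ ∑ _i ∈ Finset.range n, C := Finset.sum_le_sum fun i _ => hC _
      _ = n * C := by simp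

lemma integral_birkhoffSum {X : Type*} [MeasurableSpace X] {μ : Measure X} {T : X → X}
    (hT : MeasurePreserving T μ μ)
    {φ : X → ℝ} (hφ : Integrable φ μ) (n : ℕ) :
    ∫ x, birkhoffSum T φ n x ∂μ = n * ∫ x, φ x ∂μ := by
  have h : ∀ i, Integrable (fun x => φ (T^[i] x)) μ := fun i =>
    (hT.iterate i).integrable_comp_of_integrable hφ
  have h2 : ∀ i, ∫ x, φ (T^[i] x) ∂μ = ∫ x, φ x ∂μ := fun i => by
    have := integral_map (μ := μ) (hT.iterate i).measurable.aemeasurable (f := φ)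
      (by rw [(hT.iterate i).map_eq]; exact hφ.aestronglyMeasurable)
    rw [← this, (hT.iterate i).map_eq]
  simp only [birkhoffSum]
  rw [integral_finsetSum _ fun i _ => h i]
  simp [h2]

/-- upper Birkhoff average -/
noncomputable def upperAvg {X : Type*} (T : X → X) (φ : X → ℝ) (x : X) : ℝ :=
  limsup (fun n : ℕ => birkhoffSum T φ n x / n) atTop

lemma birkhoffAvg_mem_Icc {X : Type*} {T : X → X} {φ : X → ℝ} {C : ℝ} (h0 : ∀ x, 0 ≤ φ x)
    (hC : ∀ x, φ x ≤ C)
    (n : ℕ) (x : X) :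
    0 ≤ birkhoffSum T φ n x / n ∧ birkhoffSum T φ n x / n ≤ C := by
  have h := birkhoffSum_mem_Icc (T := T) h0 hC n x
  refine ⟨by have := h.1; positivity, ?_⟩
  rcases Nat.eq_zero_or_pos n with rfl | hn
  · simpa using (h0 x).trans (hC x)
  · rw [div_le_iff₀ (by positivity)]; linarith [h.2]

lemma upperAvg_mem_Icc {X : Type*} {T : X → X} {φ : X → ℝ} {C : ℝ} (h0 : ∀ x, 0 ≤ φ x)
    (hC : ∀ x, φ x ≤ C)
    (x : X) : 0 ≤ upperAvg T φ x ∧ upperAvg T φ x ≤ C := by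
  have h := fun n => birkhoffAvg_mem_Icc (T := T) h0 hC n x
  constructor
  · exact le_limsup_of_frequently_le (Frequently.of_forall fun n => (h n).1)
      (isBoundedUnder_of ⟨C, fun n => (h n).2⟩)
  · exact limsup_le_of_le (isCoboundedUnder_le_of_le atTop (x := 0) fun n => (h n).1)
      (Eventually.of_forall fun n => (h n).2)

lemma upperAvg_comp {X : Type*} {T : X → X} {φ : X → ℝ} {C : ℝ} (h0 : ∀ x, 0 ≤ φ x)
    (hC : ∀ x, φ x ≤ C)
    (x : X) : upperAvg T φ (T x) = upperAvg T φ x := by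
  have h := fun n x => birkhoffAvg_mem_Icc (T := T) h0 hC n x
  have hbd : ∀ y, IsBoundedUnder (· ≤ ·) atTop (fun n : ℕ => birkhoffSum T φ n y / n) :=
    fun y => isBoundedUnder_of ⟨C, fun n => (h n y).2⟩
  have hcb : ∀ y, IsCoboundedUnder (· ≤ ·) atTop (fun n : ℕ => birkhoffSum T φ n y / n) :=
    fun y => isCoboundedUnder_le_of_le atTop (x := 0) fun n => (h n y).1
  have hd : ∀ n, |birkhoffSum T φ n (T x) / n - birkhoffSum T φ n x / n| ≤ C / n := fun n => by
    rw [← sub_div, birkhoffSum_apply_sub_birkhoffSum, abs_div, Nat.abs_cast]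
    gcongr
    rw [abs_le]
    constructor <;> linarith [h0 x, hC x, h0 (T^[n] x), hC (T^[n] x)]
  have hlim : Tendsto (fun n : ℕ => C / n) atTop (𝓝 0) := tendsto_const_div_atTop_nhds_zero_nat C
  have key : ∀ y z, (∀ n : ℕ, birkhoffSum T φ n y / n ≤ birkhoffSum T φ n z / n + C / n) →
      upperAvg T φ y ≤ upperAvg T φ z := by
    intro y z hyz
    refine le_of_forall_pos_le_add fun ε hε => ?_
    have : ∀ᶠ n : ℕ in atTop, birkhoffSum T φ n z / n < upperAvg T φ z + ε / 2 :=
      eventually_lt_of_limsup_lt (by unfold upperAvg; linarith) (hbd z)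
    refine limsup_le_of_le (hcb y) ?_
    filter_upwards [this, hlim.eventually (gt_mem_nhds (half_pos hε))] with n h1 h2
    linarith [hyz n]
  refine le_antisymm (key _ _ fun n => ?_) (key _ _ fun n => ?_)
  · linarith [(abs_le.1 (hd n)).2]
  · linarith [(abs_le.1 (hd n)).1]

lemma upperAvg_iterate {X : Type*} {T : X → X} {φ : X → ℝ} {C : ℝ} (h0 : ∀ x, 0 ≤ φ x)
    (hC : ∀ x, φ x ≤ C)
    (n : ℕ) (x : X) : upperAvg T φ (T^[n] x) = upperAvg T φ x := by
  induction n with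
  | zero => rfl
  | succ n ih => rw [Function.iterate_succ_apply', upperAvg_comp h0 hC, ih]

lemma measurable_upperAvg {X : Type*} [MeasurableSpace X] {T : X → X} {φ : X → ℝ}
    (hT : Measurable T) (hφ : Measurable φ) :
    Measurable (upperAvg T φ) :=
  Measurable.limsup fun n => (measurable_birkhoffSum hT hφ n).div_const _

lemma birkhoffSum_ge_of_bad {X : Type*} {T : X → X} {φ : X → ℝ} {C : ℝ} (h0 : ∀ x, 0 ≤ φ x)
    (hC : ∀ x, φ x ≤ C)
    {h : X → ℝ} (hinv : ∀ n x, h (T^[n] x) = h x) (hhC : ∀ x, h x ≤ C)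
    {N : ℕ} {Bad : Set X}
    (hBad : ∀ x ∉ Bad, ∃ n, 1 ≤ n ∧ n ≤ N ∧ n * h x ≤ birkhoffSum T φ n x) (L : ℕ) :
    ∀ x, L * h x - N * C ≤ birkhoffSum T (φ + Bad.indicator fun _ => C) L x := by
  have hC0 : ∀ x : X, 0 ≤ C := fun x => (h0 x).trans (hC x)
  have hind : ∀ x, 0 ≤ Bad.indicator (fun _ => C) x := fun x => indicator_nonneg
    (fun y _ => hC0 y) x
  have hmono : ∀ n x, birkhoffSum T φ n x ≤ birkhoffSum T (φ + Bad.indicator fun _ => C) n x :=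
    fun n x => Finset.sum_le_sum fun i _ => by simpa using hind _
  induction L using Nat.strong_induction_on with
  | _ L ih =>
    intro x
    have hx := hC0 x
    by_cases hxB : x ∈ Bad
    · rcases Nat.eq_zero_or_pos L with rfl | hL
      · simp; positivity
      · obtain ⟨M, rfl⟩ : ∃ M, L = M + 1 := ⟨L - 1, by omega⟩
        have := ih M (by omega) (T x)
        rw [birkhoffSum_succ']
        have e := hinv 1 x
        simp only [Function.iterate_one] at e
        rw [e] at this
        simp only [Pi.add_apply, indicator_of_mem hxB]
        push_cast
        linarith [h0 x, hhC x]
    · obtain ⟨n, hn1, hnN, hn⟩ := hBad x hxB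
      rcases le_or_gt n L with hnL | hnL
      · obtain ⟨M, rfl⟩ : ∃ M, L = n + M := ⟨L - n, by omega⟩
        have := ih M (by omega) (T^[n] x)
        rw [hinv] at this
        rw [birkhoffSum_add]
        push_cast
        linarith [hmono n x]
      · have h1 := (birkhoffSum_mem_Icc (T := T) h0 hC L x).1.trans (hmono L x)
        have h2 : (L : ℝ) * h x ≤ N * C := by
          calc (L : ℝ) * h x ≤ L * C := by gcongr; exact hhC x
            _ ≤ N * C := by gcongr; omega
        linarith

lemma integral_upperAvg_le {X : Type*} [MeasurableSpace X] {T : X → X} {φ : X → ℝ} {C : ℝ}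
    (h0 : ∀ x, 0 ≤ φ x) (hC : ∀ x, φ x ≤ C)
    {μ : Measure X} [IsProbabilityMeasure μ] (hT : MeasurePreserving T μ μ)
    (hφ : Measurable φ) : ∫ x, upperAvg T φ x ∂μ ≤ ∫ x, φ x ∂μ := by
  have hC0 : 0 ≤ C := by
    have := nonempty_of_isProbabilityMeasure μ
    obtain ⟨x⟩ := this
    exact (h0 x).trans (hC x)
  have hφi : Integrable φ μ := Integrable.of_bound hφ.aestronglyMeasurable C
    (ae_of_all _ fun x => by rw [Real.norm_eq_abs, abs_of_nonneg (h0 x)]; exact hC x)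
  have hum := measurable_upperAvg hT.measurable hφ
  have hub := upperAvg_mem_Icc (T := T) h0 hC
  have hui : Integrable (upperAvg T φ) μ := Integrable.of_bound hum.aestronglyMeasurable C
    (ae_of_all _ fun x => by rw [Real.norm_eq_abs, abs_of_nonneg (hub x).1]; exact (hub x).2)
  refine le_of_forall_pos_le_add fun ε hε => ?_
  set h : X → ℝ := fun x => upperAvg T φ x - ε with hh
  let Bad : ℕ → Set X := fun N => {x | ∀ n, 1 ≤ n → n ≤ N → birkhoffSum T φ n x < n * h x}
  have hBm : ∀ N, MeasurableSet (Bad N) := fun N => by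
    have : Bad N = ⋂ n, ⋂ (_ : 1 ≤ n), ⋂ (_ : n ≤ N), {x | birkhoffSum T φ n x < n * h x} := by
      ext; simp [Bad]
    rw [this]
    refine MeasurableSet.iInter fun n => MeasurableSet.iInter fun _ =>
      MeasurableSet.iInter fun _ => ?_
    exact measurableSet_lt (measurable_birkhoffSum hT.measurable hφ n)
      ((hum.sub_const _).const_mul _)
  have hempty : ⋂ N, Bad N = ∅ := by
    rw [eq_empty_iff_forall_notMem]
    intro x hx
    have hfr : ∃ᶠ n : ℕ in atTop, h x < birkhoffSum T φ n x / n :=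
      frequently_lt_of_lt_limsup (isCoboundedUnder_le_of_le atTop (x := 0)
        fun n => (birkhoffAvg_mem_Icc (T := T) h0 hC n x).1) (by simp [hh, upperAvg, hε])
    obtain ⟨n, hn1, hn⟩ := (hfr.and_eventually (eventually_ge_atTop 1)).exists
    have := (mem_iInter.1 hx n) n hn le_rfl
    rw [lt_div_iff₀ (by positivity)] at hn1
    linarith
  have hlim : Tendsto (fun N => μ.real (Bad N)) atTop (𝓝 0) := by
    have := tendsto_measure_iInter_atTop (μ := μ) (s := Bad) (fun N => (hBm N).nullMeasurableSet)
      (fun N M hNM x hx n h1 h2 => hx n h1 (h2.trans hNM)) ⟨0, measure_ne_top _ _⟩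
    rw [hempty, measure_empty] at this
    exact (ENNReal.tendsto_toReal ENNReal.zero_ne_top).comp this
  have hhi : Integrable h μ := hui.sub (integrable_const _)
  have step : ∀ N, ∫ x, h x ∂μ ≤ ∫ x, φ x ∂μ + μ.real (Bad N) * C := by
    intro N
    have hge := birkhoffSum_ge_of_bad (T := T) (h := h) (N := N) (Bad := Bad N) h0 hC
      (fun n x => by simp only [hh, upperAvg_iterate h0 hC])
      (fun x => by simp only [hh]; linarith [(hub x).2])
      (fun x hx => by simpa [Bad] using hx)
    have hψi : Integrable (φ + (Bad N).indicator fun _ => C) μ :=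
      hφi.add ((integrable_const C).indicator (hBm N))
    have hψ : ∫ x, (φ + (Bad N).indicator fun _ => C) x ∂μ = ∫ x, φ x ∂μ + μ.real (Bad N) * C := by
      simp only [Pi.add_apply]
      rw [integral_add hφi ((integrable_const C).indicator (hBm N)),
        integral_indicator_const _ (hBm N), smul_eq_mul]
    rw [← hψ]
    have hL : ∀ L : ℕ, L * ∫ x, h x ∂μ - N * C ≤
        L * ∫ x, (φ + (Bad N).indicator fun _ => C) x ∂μ := by
      intro L
      rw [← integral_birkhoffSum hT hψi L]
      have : L * ∫ x, h x ∂μ - N * C = ∫ x, (L * h x - N * C) ∂μ := by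
        rw [integral_sub (hhi.const_mul _) (integrable_const _), integral_const_mul]; simp
      rw [this]
      refine integral_mono ((hhi.const_mul _).sub (integrable_const _)) ?_ (hge L)
      unfold birkhoffSum
      exact integrable_finsetSum _ fun i _ => (hT.iterate i).integrable_comp_of_integrable hψi
    by_contra! hlt
    obtain ⟨L, hL'⟩ := exists_nat_gt ((N * C) /
      (∫ x, h x ∂μ - ∫ x, (φ + (Bad N).indicator fun _ => C) x ∂μ))
    rw [div_lt_iff₀ (by linarith)] at hL'
    linarith [hL L]
  have := ge_of_tendsto' ((hlim.mul_const C).const_add (∫ x, φ x ∂μ)) step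
  have e : ∫ x, h x ∂μ = ∫ x, upperAvg T φ x ∂μ - ε := by
    rw [hh, integral_sub hui (integrable_const _)]; simp
  linarith

/-- **Pointwise ergodic theorem** for bounded observables. -/
theorem exists_ae_tendsto_birkhoffSum_div {X : Type*} [MeasurableSpace X] {μ : Measure X}
    [IsProbabilityMeasure μ] {T : X → X}
    (hT : MeasurePreserving T μ μ) {φ : X → ℝ} (hφ : Measurable φ) {B : ℝ} (hB : ∀ x, |φ x| ≤ B) :
    ∃ ψ : X → ℝ, Integrable ψ μ ∧ ∫ x, ψ x ∂μ = ∫ x, φ x ∂μ ∧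
      ∀ᵐ x ∂μ, Tendsto (fun n : ℕ => birkhoffSum T φ n x / n) atTop (𝓝 (ψ x)) := by
  have hφi : Integrable φ μ := Integrable.of_bound hφ.aestronglyMeasurable B (ae_of_all _ hB)
  have hB' := fun x => abs_le.1 (hB x)
  set p : X → ℝ := fun x => φ x + B with hp
  set q : X → ℝ := fun x => B - φ x with hq
  have hp0 : ∀ x, 0 ≤ p x := fun x => by simp only [hp]; linarith [hB' x]
  have hpC : ∀ x, p x ≤ 2 * B := fun x => by simp only [hp]; linarith [hB' x]
  have hq0 : ∀ x, 0 ≤ q x := fun x => by simp only [hq]; linarith [hB' x]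
  have hqC : ∀ x, q x ≤ 2 * B := fun x => by simp only [hq]; linarith [hB' x]
  have hpm : Measurable p := hφ.add_const _
  have hqm : Measurable q := hφ.const_sub _
  have hpu := upperAvg_mem_Icc (T := T) hp0 hpC
  have hqu := upperAvg_mem_Icc (T := T) hq0 hqC
  have hui : Integrable (upperAvg T p) μ := Integrable.of_bound
    (measurable_upperAvg hT.measurable hpm).aestronglyMeasurable (2 * B)
    (ae_of_all _ fun x => by rw [Real.norm_eq_abs, abs_of_nonneg (hpu x).1]; exact (hpu x).2)
  have hvi : Integrable (upperAvg T q) μ := Integrable.of_bound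
    (measurable_upperAvg hT.measurable hqm).aestronglyMeasurable (2 * B)
    (ae_of_all _ fun x => by rw [Real.norm_eq_abs, abs_of_nonneg (hqu x).1]; exact (hqu x).2)
  have h1 := integral_upperAvg_le hp0 hpC hT hpm
  have h2 := integral_upperAvg_le hq0 hqC hT hqm
  have h3 : ∫ x, p x ∂μ = ∫ x, φ x ∂μ + B := by
    rw [hp, integral_add hφi (integrable_const _)]; simp
  have h4 : ∫ x, q x ∂μ = B - ∫ x, φ x ∂μ := by
    rw [hq, integral_sub (integrable_const _) hφi]; simp
  have hsum : ∀ x (n : ℕ), 1 ≤ n →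
      birkhoffSum T p n x / n = birkhoffSum T φ n x / n + B ∧
      birkhoffSum T q n x / n = B - birkhoffSum T φ n x / n := by
    intro x n hn
    have : (n : ℝ) ≠ 0 := by positivity
    simp only [birkhoffSum, hp, hq, Finset.sum_add_distrib, Finset.sum_sub_distrib]
    constructor <;> (simp; field_simp)
  have hev : ∀ x (δ : ℝ), 0 < δ → ∀ᶠ n : ℕ in atTop,
      birkhoffSum T φ n x / n < upperAvg T p x - B + δ ∧
      B - upperAvg T q x - δ < birkhoffSum T φ n x / n := by
    intro x δ hδ
    have e1 : ∀ᶠ n : ℕ in atTop, birkhoffSum T p n x / n < upperAvg T p x + δ :=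
      eventually_lt_of_limsup_lt (by unfold upperAvg; linarith)
        (isBoundedUnder_of ⟨2 * B, fun n => (birkhoffAvg_mem_Icc hp0 hpC n x).2⟩)
    have e2 : ∀ᶠ n : ℕ in atTop, birkhoffSum T q n x / n < upperAvg T q x + δ :=
      eventually_lt_of_limsup_lt (by unfold upperAvg; linarith)
        (isBoundedUnder_of ⟨2 * B, fun n => (birkhoffAvg_mem_Icc hq0 hqC n x).2⟩)
    filter_upwards [e1, e2, eventually_ge_atTop 1] with n h1 h2 hn
    have := hsum x n hn
    constructor <;> linarith
  have hge : ∀ x, 0 ≤ upperAvg T p x + upperAvg T q x - 2 * B := by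
    intro x
    by_contra! hlt
    obtain ⟨n, hn⟩ := (hev x (-(upperAvg T p x + upperAvg T q x - 2 * B) / 2) (by linarith)).exists
    linarith [hn.1, hn.2]
  have hi : Integrable (fun x => upperAvg T p x + upperAvg T q x - 2 * B) μ :=
    (hui.add hvi).sub (integrable_const _)
  have hint : ∫ x, (upperAvg T p x + upperAvg T q x - 2 * B) ∂μ =
      ∫ x, upperAvg T p x ∂μ + ∫ x, upperAvg T q x ∂μ - 2 * B := by
    have e := integral_sub (hui.add hvi) (integrable_const (2 * B))
    simp only [Pi.add_apply] at e
    rw [e, integral_add hui hvi]; simp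
  have h0int : 0 ≤ ∫ x, (upperAvg T p x + upperAvg T q x - 2 * B) ∂μ := integral_nonneg hge
  have hz : (fun x => upperAvg T p x + upperAvg T q x - 2 * B) =ᵐ[μ] 0 :=
    (integral_eq_zero_iff_of_nonneg hge hi).1 (by linarith)
  refine ⟨fun x => upperAvg T p x - B, hui.sub (integrable_const _), ?_, ?_⟩
  · rw [integral_sub hui (integrable_const _)]; simp; linarith
  · filter_upwards [hz] with x hx
    simp only [Pi.zero_apply] at hx
    rw [Metric.tendsto_nhds]
    intro δ hδ
    filter_upwards [hev x δ hδ] with n hn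
    rw [Real.dist_eq, abs_lt]
    constructor <;> linarith [hn.1, hn.2]

end Birkhoff

section Shannon

/-- The itinerary of `x` during the first `n` steps, with respect to the labelling `d`. -/
def itin {X ι : Type*} (T : X → X) (d : X → ι) (n : ℕ) (x : X) : Fin n → ι :=
  fun t => d (T^[t] x)

/-- The σ-algebra generated by all itineraries. -/
abbrev futureAlg {X ι : Type*} (T : X → X) (d : X → ι) : MeasurableSpace X :=
  ⨆ n, MeasurableSpace.comap (itin T d n) ⊤

/-- The conditional probability of the label `e` given the strict future. -/
noncomputable def condP {X ι : Type*} [MeasurableSpace X] (μ : Measure X) (T : X → X)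
    (d : X → ι) (e : ι) : X → ℝ :=
  μ[(d ⁻¹' {e}).indicator (fun _ => (1 : ℝ)) | (futureAlg T d).comap T]

/-- The conditional probability of a label, clipped to `[exp (-K), 1]`. -/
noncomputable def clipP {X ι : Type*} [MeasurableSpace X] (μ : Measure X) (T : X → X)
    (d : X → ι) (K : ℕ) (e : ι) (x : X) : ℝ :=
  max (min (condP μ T d e x) 1) (Real.exp (-K))

/-- The clipped conditional information of the label of `x` given its strict future. -/
noncomputable def clipInfo {X ι : Type*} [MeasurableSpace X] (μ : Measure X) (T : X → X)
    (d : X → ι) (K : ℕ) (x : X) : ℝ :=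
  -Real.log (clipP μ T d K (d x) x)

lemma measurable_top_of_fiber {X κ : Type*} [MeasurableSpace X] [Finite κ] {W : X → κ}
    (hW : ∀ c, MeasurableSet (W ⁻¹' {c})) : Measurable[_, ⊤] W := by
  intro s _
  rw [← biUnion_of_singleton s, preimage_iUnion₂]
  exact MeasurableSet.biUnion (toFinite s).countable fun c _ => hW c

lemma comp_eq_sum_indicator {X κ : Type*} [Fintype κ] (W : X → κ) (F : κ → X → ℝ) (x : X) :
    F (W x) x = ∑ c, (W ⁻¹' {c}).indicator (F c) x := by
  classical
  rw [Finset.sum_eq_single (W x)]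
  · simp
  · intro c _ hc
    exact indicator_of_notMem (by simpa using hc.symm) _
  · simp

lemma integral_comp_fintype {X κ : Type*} [MeasurableSpace X] [Fintype κ] {μ : Measure X}
    [IsFiniteMeasure μ] {W : X → κ} (hW : ∀ c, MeasurableSet (W ⁻¹' {c})) (F : κ → ℝ) :
    ∫ x, F (W x) ∂μ = ∑ c, μ.real (W ⁻¹' {c}) * F c := by
  simp_rw [fun x => comp_eq_sum_indicator W (fun c _ => F c) x]
  rw [integral_finsetSum _ fun c _ => (integrable_const (F c)).indicator (hW c)]
  refine Finset.sum_congr rfl fun c _ => ?_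
  rw [integral_indicator_const _ (hW c), smul_eq_mul]

lemma condExp_comap_fintype {X κ : Type*} [MeasurableSpace X] [Fintype κ] {μ : Measure X}
    [IsFiniteMeasure μ] {W : X → κ} (hW : ∀ c, MeasurableSet (W ⁻¹' {c})) {E : Set X}
    (hE : MeasurableSet E) :
    (fun x => μ.real (E ∩ W ⁻¹' {W x}) / μ.real (W ⁻¹' {W x})) =ᵐ[μ]
      μ[E.indicator (fun _ => (1 : ℝ)) | MeasurableSpace.comap W ⊤] := by
  classical
  have hWm := measurable_top_of_fiber hW
  have hm : MeasurableSpace.comap W ⊤ ≤ ‹MeasurableSpace X› := hWm.comap_le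
  set F : κ → ℝ := fun c => μ.real (E ∩ W ⁻¹' {c}) / μ.real (W ⁻¹' {c}) with hF
  have hFi : Integrable (fun x => F (W x)) μ := by
    simp_rw [fun x => comp_eq_sum_indicator W (fun c _ => F c) x]
    exact integrable_finsetSum _ fun c _ => (integrable_const (F c)).indicator (hW c)
  refine ae_eq_condExp_of_forall_setIntegral_eq hm ((integrable_const _).indicator hE)
    (fun s _ _ => hFi.integrableOn) ?_ ?_
  · rintro _ ⟨t, -, rfl⟩ -
    have htm : MeasurableSet (W ⁻¹' t) := hWm (MeasurableSpace.measurableSet_top)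
    have e1 : ∫ x in W ⁻¹' t, F (W x) ∂μ = ∑ c, if c ∈ t then μ.real (E ∩ W ⁻¹' {c}) else 0 := by
      rw [← integral_indicator htm]
      have : ∀ x, (W ⁻¹' t).indicator (fun x => F (W x)) x =
          (fun c => if c ∈ t then F c else 0) (W x) := by
        intro x; simp [indicator]
      simp_rw [this]
      refine (integral_comp_fintype hW (fun c => if c ∈ t then F c else 0)).trans ?_
      refine Finset.sum_congr rfl fun c _ => ?_
      split_ifs
      · simp only [hF]
        rcases eq_or_ne (μ.real (W ⁻¹' {c})) 0 with h | h
        · rw [h, zero_mul]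
          exact (measureReal_mono_null inter_subset_right h).symm
        · field_simp
      · simp
    have e2 : ∫ x in W ⁻¹' t, E.indicator (fun _ => (1 : ℝ)) x ∂μ = μ.real (E ∩ W ⁻¹' t) := by
      rw [setIntegral_indicator hE, setIntegral_const]; simp [inter_comm]
    have e3 : μ.real (E ∩ W ⁻¹' t) = ∑ c, if c ∈ t then μ.real (E ∩ W ⁻¹' {c}) else 0 := by
      rw [← Finset.sum_filter]
      have : E ∩ W ⁻¹' t = ⋃ c ∈ Finset.univ.filter (· ∈ t), E ∩ W ⁻¹' {c} := by
        ext x; simp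
      rw [this, measureReal_biUnion_finset]
      · intro a _ b _ hab
        refine disjoint_left.2 fun x hx hx' => hab ?_
        rw [← hx.2, ← hx'.2]
      · exact fun c _ => hE.inter (hW c)
    rw [e2, e3, ← e1]
  · exact ((measurable_from_top (f := F)).comp (comap_measurable W)).aestronglyMeasurable

lemma integral_condExp_mul {X : Type*} {m m0 : MeasurableSpace X} (hm : m ≤ m0) {μ : Measure X}
    [IsFiniteMeasure μ] {E : Set X} (hE : MeasurableSet E) {Z : X → ℝ} (hZ : Measurable[m] Z)
    {B : ℝ} (hB : ∀ x, |Z x| ≤ B) :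
    ∫ x, E.indicator (fun _ => (1 : ℝ)) x * Z x ∂μ =
      ∫ x, (μ[E.indicator (fun _ => (1 : ℝ)) | m]) x * Z x ∂μ := by
  have h1 : Integrable (E.indicator fun _ => (1 : ℝ)) μ := (integrable_const _).indicator hE
  have h2 : Integrable (E.indicator (fun _ => (1 : ℝ)) * Z) μ :=
    h1.mul_bdd (c := B) (hZ.mono hm le_rfl).aestronglyMeasurable (ae_of_all _ hB)
  have h3 := condExp_mul_of_stronglyMeasurable_right (μ := μ) hZ.stronglyMeasurable h2 h1
  calc _ = ∫ x, (μ[E.indicator (fun _ => (1 : ℝ)) * Z | m]) x ∂μ := (integral_condExp hm).symm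
    _ = _ := integral_congr_ae h3

lemma condExp_indicator_mem_Icc {X : Type*} {m m0 : MeasurableSpace X} (hm : m ≤ m0)
    {μ : Measure X} [IsFiniteMeasure μ] {E : Set X} (hE : MeasurableSet E) :
    ∀ᵐ x ∂μ, (μ[E.indicator (fun _ => (1 : ℝ)) | m]) x ∈ Icc (0 : ℝ) 1 := by
  have h1 : Integrable (E.indicator fun _ => (1 : ℝ)) μ := (integrable_const _).indicator hE
  have h0 : 0 ≤ᵐ[μ] μ[E.indicator (fun _ => (1 : ℝ)) | m] :=
    condExp_nonneg (ae_of_all _ fun x => indicator_nonneg (fun _ _ => zero_le_one) x)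
  have h2 : μ[E.indicator (fun _ => (1 : ℝ)) | m] ≤ᵐ[μ] μ[fun _ => (1 : ℝ) | m] :=
    condExp_mono h1 (integrable_const _)
      (ae_of_all _ fun x => indicator_le_self' (fun _ _ => zero_le_one) x)
  rw [condExp_const hm] at h2
  filter_upwards [h0, h2] with x hx hx' using ⟨hx, hx'⟩

lemma measurableSet_itin_fiber {X ι : Type*} [MeasurableSpace X] {T : X → X} {d : X → ι}
    (hT : Measurable T) (hd : ∀ e, MeasurableSet (d ⁻¹' {e})) (n : ℕ)
    (c : Fin n → ι) : MeasurableSet (itin T d n ⁻¹' {c}) := by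
  have : itin T d n ⁻¹' {c} = ⋂ t : Fin n, T^[t] ⁻¹' (d ⁻¹' {c t}) := by
    ext x; simp [itin, funext_iff]
  rw [this]
  exact MeasurableSet.iInter fun t => hT.iterate _ (hd _)

lemma comap_itin_le_futureAlg {X ι : Type*} (T : X → X) (d : X → ι) (n : ℕ) :
    MeasurableSpace.comap (itin T d n) ⊤ ≤ futureAlg T d :=
  le_iSup (fun n => MeasurableSpace.comap (itin T d n) ⊤) n

lemma futureAlg_le {X ι : Type*} [MeasurableSpace X] [Finite ι] {T : X → X} {d : X → ι}
    (hT : Measurable T) (hd : ∀ e, MeasurableSet (d ⁻¹' {e})) :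
    futureAlg T d ≤ ‹MeasurableSpace X› :=
  iSup_le fun n => (measurable_top_of_fiber (measurableSet_itin_fiber hT hd n)).comap_le

/-- The filtration whose limit is the strict future. -/
def futureFiltration {X ι : Type*} [MeasurableSpace X] [Finite ι] {T : X → X} {d : X → ι}
    (hT : Measurable T) (hd : ∀ e, MeasurableSet (d ⁻¹' {e})) :
    Filtration ℕ ‹MeasurableSpace X› where
  seq n := (MeasurableSpace.comap (itin T d n) ⊤).comap T
  mono' := by
    intro n m hnm
    refine MeasurableSpace.comap_mono ?_
    have : itin T d n = (fun c t => c (Fin.castLE hnm t)) ∘ itin T d m := rfl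
    rw [this, ← MeasurableSpace.comap_comp]
    exact MeasurableSpace.comap_mono le_top
  le' n := ((MeasurableSpace.comap_mono
    ((comap_itin_le_futureAlg T d n).trans (futureAlg_le hT hd))).trans hT.comap_le)

lemma iSup_futureFiltration {X ι : Type*} [MeasurableSpace X] [Finite ι] {T : X → X} {d : X → ι}
    (hT : Measurable T) (hd : ∀ e, MeasurableSet (d ⁻¹' {e})) :
    ⨆ n, futureFiltration hT hd n = (futureAlg T d).comap T := by
  rw [futureAlg, MeasurableSpace.comap_iSup]; rfl

lemma itin_succ_fiber {X ι : Type*} (T : X → X) (d : X → ι) {n : ℕ} (e : ι) (c : Fin n → ι) :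
    itin T d (n + 1) ⁻¹' {Fin.cons e c} = d ⁻¹' {e} ∩ (itin T d n ∘ T) ⁻¹' {c} := by
  ext x
  simp only [mem_preimage, mem_singleton_iff, mem_inter_iff, Function.comp_apply, funext_iff,
    Fin.forall_fin_succ, Fin.cons_zero, Fin.cons_succ]
  rfl

/-- Entropy of the itinerary of length `n`. -/
noncomputable def itinEnt {X ι : Type*} [MeasurableSpace X] [Fintype ι]
    (μ : Measure X) (T : X → X) (d : X → ι) (n : ℕ) : ℝ :=
  ∑ c : Fin n → ι, Real.negMulLog (μ.real (itin T d n ⁻¹' {c}))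

lemma integral_negMulLog_condExp {X ι : Type*} [MeasurableSpace X] [Fintype ι] {T : X → X}
    {d : X → ι}
    {μ : Measure X} [IsProbabilityMeasure μ]
    (hT : MeasurePreserving T μ μ) (hd : ∀ e, MeasurableSet (d ⁻¹' {e})) (n : ℕ) :
    ∑ e, ∫ x, Real.negMulLog ((μ[(d ⁻¹' {e}).indicator (fun _ => (1 : ℝ)) |
      futureFiltration hT.measurable hd n]) x) ∂μ = itinEnt μ T d (n + 1) - itinEnt μ T d n := by
  have hW : ∀ c, MeasurableSet ((itin T d n ∘ T) ⁻¹' {c}) := fun c =>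
    hT.measurable (measurableSet_itin_fiber hT.measurable hd n c)
  have hpres : ∀ c, μ.real ((itin T d n ∘ T) ⁻¹' {c}) = μ.real (itin T d n ⁻¹' {c}) := fun c => by
    rw [preimage_comp]
    exact hT.measureReal_preimage (measurableSet_itin_fiber hT.measurable hd n c).nullMeasurableSet
  have hfil : (futureFiltration hT.measurable hd n : MeasurableSpace X) =
      MeasurableSpace.comap (itin T d n ∘ T) ⊤ := MeasurableSpace.comap_comp
  have h1 : ∀ e, ∫ x, Real.negMulLog ((μ[(d ⁻¹' {e}).indicator (fun _ => (1 : ℝ)) |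
      futureFiltration hT.measurable hd n]) x) ∂μ = ∑ c : Fin n → ι,
        (Real.negMulLog (μ.real (itin T d (n + 1) ⁻¹' {Fin.cons e c}))
          + μ.real (itin T d (n + 1) ⁻¹' {Fin.cons e c}) *
            Real.log (μ.real (itin T d n ⁻¹' {c}))) := by
    intro e
    rw [hfil]
    have := condExp_comap_fintype (μ := μ) hW (hd e)
    refine (integral_congr_ae (this.fun_comp Real.negMulLog)).symm.trans ?_
    refine (integral_comp_fintype hW (fun c => Real.negMulLog (μ.real (d ⁻¹' {e} ∩
      (itin T d n ∘ T) ⁻¹' {c}) / μ.real ((itin T d n ∘ T) ⁻¹' {c})))).trans ?_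
    refine Finset.sum_congr rfl fun c _ => ?_
    rw [← itin_succ_fiber, hpres]
    set p := μ.real (itin T d n ⁻¹' {c})
    set q := μ.real (itin T d (n + 1) ⁻¹' {Fin.cons e c}) with hq
    rcases eq_or_ne p 0 with hp | hp
    · have : q = 0 := by
        rw [hq, itin_succ_fiber]
        exact measureReal_mono_null inter_subset_right ((hpres c).trans hp)
      simp [hp, this]
    · rcases eq_or_ne q 0 with hq0 | hq0
      · simp [hq0]
      · simp only [Real.negMulLog]
        rw [Real.log_div hq0 hp]
        field_simp
        ring
  simp_rw [h1, Finset.sum_add_distrib]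
  have h2 : ∑ e, ∑ c : Fin n → ι, Real.negMulLog (μ.real (itin T d (n + 1) ⁻¹' {Fin.cons e c})) =
      itinEnt μ T d (n + 1) := by
    rw [itinEnt, ← (Fin.consEquiv fun _ => ι).sum_comp, Fintype.sum_prod_type]
    rfl
  have h3 : ∀ c : Fin n → ι, ∑ e, μ.real (itin T d (n + 1) ⁻¹' {Fin.cons e c}) =
      μ.real (itin T d n ⁻¹' {c}) := by
    intro c
    rw [← hpres, ← measureReal_biUnion_finset]
    · congr 1
      ext x
      simp [itin_succ_fiber]
    · intro a _ b _ hab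
      refine disjoint_left.2 fun x hx hx' => hab ?_
      simp only [itin_succ_fiber] at hx hx'
      rw [← hx.1, ← hx'.1]
    · exact fun e _ => measurableSet_itin_fiber hT.measurable hd _ _
  rw [h2, Finset.sum_comm]
  simp_rw [← Finset.sum_mul, h3, itinEnt, Real.negMulLog]
  rw [sub_eq_add_neg, ← Finset.sum_neg_distrib]
  simp

lemma abs_negMulLog_le_one {u : ℝ} (hu : u ∈ Icc (0 : ℝ) 1) : ‖Real.negMulLog u‖ ≤ 1 := by
  rw [Real.norm_eq_abs, abs_of_nonneg (Real.negMulLog_nonneg hu.1 hu.2)]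
  linarith [Real.negMulLog_le_one_sub_self hu.1, hu.1]

lemma tendsto_itinEnt_div {X ι : Type*} [MeasurableSpace X] [Fintype ι] {T : X → X} {d : X → ι}
    {μ : Measure X} [IsProbabilityMeasure μ]
    (hT : MeasurePreserving T μ μ) (hd : ∀ e, MeasurableSet (d ⁻¹' {e})) :
    Tendsto (fun n : ℕ => itinEnt μ T d n / n) atTop
      (𝓝 (∑ e, ∫ x, Real.negMulLog (condP μ T d e x) ∂μ)) := by
  have hlim : Tendsto (fun n => itinEnt μ T d (n + 1) - itinEnt μ T d n) atTop
      (𝓝 (∑ e, ∫ x, Real.negMulLog (condP μ T d e x) ∂μ)) := by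
    simp_rw [← integral_negMulLog_condExp hT hd]
    refine tendsto_finsetSum _ fun e _ => ?_
    refine tendsto_integral_of_dominated_convergence (fun _ => (1 : ℝ)) (fun n => ?_)
      (integrable_const _) (fun n => ?_) ?_
    · exact Real.continuous_negMulLog.comp_aestronglyMeasurable
        (stronglyMeasurable_condExp.mono
          ((futureFiltration hT.measurable hd).le n)).aestronglyMeasurable
    · filter_upwards [condExp_indicator_mem_Icc (μ := μ)
        ((futureFiltration hT.measurable hd).le n) (hd e)] with x hx
      exact abs_negMulLog_le_one hx
    · have := tendsto_ae_condExp (μ := μ) (ℱ := futureFiltration hT.measurable hd)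
        ((d ⁻¹' {e}).indicator (fun _ => (1 : ℝ)))
      rw [iSup_futureFiltration] at this
      filter_upwards [this] with x hx
      exact (Real.continuous_negMulLog.tendsto _).comp hx
  have h0 : itinEnt μ T d 0 = 0 := by
    have : ∀ c : Fin 0 → ι, itin T d 0 ⁻¹' {c} = univ := fun c => by
      ext x; simp [Subsingleton.elim (itin T d 0 x) c]
    simp [itinEnt, this]
  have := hlim.cesaro
  simp_rw [Finset.sum_range_sub, h0, sub_zero] at this
  simpa [div_eq_inv_mul] using this

lemma clipP_mem_Icc {X ι : Type*} [MeasurableSpace X] (μ : Measure X) (T : X → X) (d : X → ι)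
    (K : ℕ) (e : ι) (x : X) : Real.exp (-K) ≤ clipP μ T d K e x ∧ clipP μ T d K e x ≤ 1 :=
  ⟨le_max_right _ _, max_le (min_le_right _ _) (Real.exp_le_one_iff.2 (by simp))⟩

lemma clipP_pos {X ι : Type*} [MeasurableSpace X] (μ : Measure X) (T : X → X) (d : X → ι)
    (K : ℕ) (e : ι) (x : X) : 0 < clipP μ T d K e x :=
  (Real.exp_pos _).trans_le (clipP_mem_Icc μ T d K e x).1

lemma neg_log_clipP_mem_Icc {X ι : Type*} [MeasurableSpace X] (μ : Measure X) (T : X → X)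
    (d : X → ι) (K : ℕ) (e : ι) (x : X) :
    0 ≤ -Real.log (clipP μ T d K e x) ∧ -Real.log (clipP μ T d K e x) ≤ K := by
  have h := clipP_mem_Icc μ T d K e x
  have hp := clipP_pos μ T d K e x
  constructor
  · linarith [Real.log_nonpos hp.le h.2]
  · have := Real.log_le_log (Real.exp_pos _) h.1
    rw [Real.log_exp] at this
    linarith

lemma measurable_condP {X ι : Type*} [MeasurableSpace X] (μ : Measure X) (T : X → X) (d : X → ι)
    (e : ι) : Measurable[(futureAlg T d).comap T] (condP μ T d e) :=
  stronglyMeasurable_condExp.measurable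

lemma measurable_clipP {X ι : Type*} [MeasurableSpace X] (μ : Measure X) (T : X → X) (d : X → ι)
    (K : ℕ) (e : ι) : Measurable[(futureAlg T d).comap T] (clipP μ T d K e) :=
  ((measurable_condP μ T d e).min measurable_const).max measurable_const

lemma comap_futureAlg_le {X ι : Type*} [MeasurableSpace X] [Finite ι] {T : X → X} {d : X → ι}
    (hT : Measurable T) (hd : ∀ e, MeasurableSet (d ⁻¹' {e})) :
    (futureAlg T d).comap T ≤ ‹MeasurableSpace X› :=
  (MeasurableSpace.comap_mono (futureAlg_le hT hd)).trans hT.comap_le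

lemma measurable_clipInfo {X ι : Type*} [MeasurableSpace X] [Fintype ι] {T : X → X} {d : X → ι}
    {μ : Measure X} (hT : Measurable T)
    (hd : ∀ e, MeasurableSet (d ⁻¹' {e})) (K : ℕ) : Measurable (clipInfo μ T d K) := by
  have : clipInfo μ T d K = fun x => ∑ e, (d ⁻¹' {e}).indicator
      (fun x => -Real.log (clipP μ T d K e x)) x := by
    ext x
    exact comp_eq_sum_indicator d (fun e x => -Real.log (clipP μ T d K e x)) x
  rw [this]
  refine Finset.measurable_sum _ fun e _ => Measurable.indicator ?_ (hd e)
  exact (Real.measurable_log.comp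
    ((measurable_clipP μ T d K e).mono (comap_futureAlg_le hT hd) le_rfl)).neg

lemma tendsto_integral_clipInfo {X ι : Type*} [MeasurableSpace X] [Fintype ι] {T : X → X}
    {d : X → ι}
    {μ : Measure X} [IsProbabilityMeasure μ]
    (hT : MeasurePreserving T μ μ) (hd : ∀ e, MeasurableSet (d ⁻¹' {e})) :
    Tendsto (fun K : ℕ => ∫ x, clipInfo μ T d K x ∂μ) atTop
      (𝓝 (∑ e, ∫ x, Real.negMulLog (condP μ T d e x) ∂μ)) := by
  have hle := comap_futureAlg_le hT.measurable hd
  have hm : ∀ K e, Measurable[(futureAlg T d).comap T]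
      (fun x => -Real.log (clipP μ T d K e x)) := fun K e =>
    (Real.measurable_log.comp (measurable_clipP μ T d K e)).neg
  have hbd : ∀ (K : ℕ) e x, |-Real.log (clipP μ T d K e x)| ≤ K := fun K e x => by
    have := neg_log_clipP_mem_Icc μ T d K e x
    rw [abs_of_nonneg this.1]; exact this.2
  have h1 : ∀ K : ℕ, ∫ x, clipInfo μ T d K x ∂μ =
      ∑ e, ∫ x, condP μ T d e x * -Real.log (clipP μ T d K e x) ∂μ := by
    intro K
    have : clipInfo μ T d K = fun x => ∑ e, (d ⁻¹' {e}).indicator (fun _ => (1 : ℝ)) x *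
        -Real.log (clipP μ T d K e x) := by
      ext x
      rw [clipInfo, comp_eq_sum_indicator d (fun e x => -Real.log (clipP μ T d K e x)) x]
      refine Finset.sum_congr rfl fun e _ => ?_
      by_cases hx : x ∈ d ⁻¹' {e} <;> simp [hx]
    rw [this, integral_finsetSum]
    · exact Finset.sum_congr rfl fun e _ => integral_condExp_mul hle (hd e) (hm K e) (hbd K e)
    · intro e _
      exact ((integrable_const (1 : ℝ)).indicator (hd e)).mul_bdd (c := K)
        ((hm K e).mono hle le_rfl).aestronglyMeasurable (ae_of_all _ (hbd K e))
  simp_rw [h1]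
  refine tendsto_finsetSum _ fun e _ => ?_
  have hmem := condExp_indicator_mem_Icc (μ := μ) hle (hd e)
  refine tendsto_integral_of_dominated_convergence (fun _ => (1 : ℝ)) (fun K => ?_)
    (integrable_const _) (fun K => ?_) ?_
  · exact (((measurable_condP μ T d e).mul (hm K e)).mono hle le_rfl).aestronglyMeasurable
  · filter_upwards [hmem] with x hx
    change condP μ T d e x ∈ Icc 0 1 at hx
    have h2 := neg_log_clipP_mem_Icc μ T d K e x
    rw [Real.norm_eq_abs, abs_of_nonneg (mul_nonneg hx.1 h2.1)]
    refine le_trans ?_ ((le_abs_self _).trans (abs_negMulLog_le_one hx))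
    rcases hx.1.eq_or_lt with h0 | h0
    · simp [← h0]
    · rw [Real.negMulLog, neg_mul, ← mul_neg]
      refine mul_le_mul_of_nonneg_left (neg_le_neg (Real.log_le_log h0 ?_)) hx.1
      rw [clipP, min_eq_left hx.2]
      exact le_max_left _ _
  · filter_upwards [hmem] with x hx
    change condP μ T d e x ∈ Icc 0 1 at hx
    refine tendsto_const_nhds.congr' ?_
    rcases hx.1.eq_or_lt with h0 | h0
    · exact Eventually.of_forall fun K => by simp [← h0]
    · have : Tendsto (fun K : ℕ => Real.exp (-K)) atTop (𝓝 0) :=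
        Real.tendsto_exp_neg_atTop_nhds_zero.comp tendsto_natCast_atTop_atTop
      filter_upwards [this.eventually (gt_mem_nhds h0)] with K hK
      rw [clipP, min_eq_left hx.2, max_eq_left hK.le, Real.negMulLog, neg_mul, mul_neg]

end Shannon

section Schedule

lemma measurable_label_futureAlg {X ι : Type*} (T : X → X) (d : X → ι) :
    Measurable[futureAlg T d, ⊤] d := by
  intro s _
  exact comap_itin_le_futureAlg T d 1 _ ⟨(fun c => c 0) ⁻¹' s, trivial, rfl⟩

lemma measurable_futureAlg_self {X ι : Type*} (T : X → X) (d : X → ι) :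
    Measurable[futureAlg T d, futureAlg T d] T := by
  refine measurable_iff_comap_le.2 ?_
  rw [futureAlg, MeasurableSpace.comap_iSup]
  refine iSup_le fun n => ?_
  rw [MeasurableSpace.comap_comp]
  refine le_trans ?_ (comap_itin_le_futureAlg T d (n + 1))
  have : itin T d n ∘ T = (fun c t => c (Fin.succ t)) ∘ itin T d (n + 1) := rfl
  rw [this, ← MeasurableSpace.comap_comp]
  exact MeasurableSpace.comap_mono le_top

lemma measurable_clipInfo_futureAlg {X ι : Type*} [MeasurableSpace X] [Fintype ι] {μ : Measure X}
    (T : X → X) (d : X → ι) (K : ℕ) : Measurable[futureAlg T d] (clipInfo μ T d K) := by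
  have : clipInfo μ T d K = fun x => ∑ e, (d ⁻¹' {e}).indicator
      (fun x => -Real.log (clipP μ T d K e x)) x := by
    ext x
    exact comp_eq_sum_indicator d (fun e x => -Real.log (clipP μ T d K e x)) x
  rw [this]
  refine Finset.measurable_sum _ fun e _ => Measurable.indicator ?_
    (measurable_label_futureAlg T d (MeasurableSpace.measurableSet_top))
  exact (Real.measurable_log.comp ((measurable_clipP μ T d K e).mono
    (measurable_iff_comap_le.1 (measurable_futureAlg_self T d)) le_rfl)).neg

/-- The itinerary of `x` when the labelling used at time `t` is `δ t`. -/
def schedName {X ι : Type*} (T : X → X) (δ : ℕ → X → ι) (r : ℕ) (x : X) : Fin r → ι :=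
  fun t => δ t (T^[t] x)

/-- The accumulated clipped information along a schedule of labellings. -/
noncomputable def schedInfo {X ι : Type*} [MeasurableSpace X] (μ : Measure X) (T : X → X)
    (δ : ℕ → X → ι) (K r : ℕ) (x : X) : ℝ :=
  ∑ t ∈ Finset.range r, clipInfo μ T (δ t) K (T^[t] x)

lemma clipInfo_mem_Icc {X ι : Type*} [MeasurableSpace X] (μ : Measure X) (T : X → X)
    (d : X → ι) (K : ℕ) (x : X) : 0 ≤ clipInfo μ T d K x ∧ clipInfo μ T d K x ≤ K :=
  neg_log_clipP_mem_Icc μ T d K (d x) x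

lemma schedInfo_le {X ι : Type*} [MeasurableSpace X] (μ : Measure X) (T : X → X)
    (δ : ℕ → X → ι) (K r : ℕ) (x : X) : schedInfo μ T δ K r x ≤ r * K := by
  refine (Finset.sum_le_card_nsmul _ _ (K : ℝ) fun t _ => (clipInfo_mem_Icc μ T _ K _).2).trans ?_
  simp

lemma schedName_succ_fiber {X ι : Type*} (T : X → X) (δ : ℕ → X → ι) {r : ℕ} (x y : X) :
    schedName T δ (r + 1) y = schedName T δ (r + 1) x ↔
      δ 0 y = δ 0 x ∧ schedName T (fun t => δ (t + 1)) r (T y) =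
        schedName T (fun t => δ (t + 1)) r (T x) := by
  simp only [funext_iff, Fin.forall_fin_succ, schedName]
  rfl

lemma measurable_schedName {X ι : Type*} [Finite ι] {m : MeasurableSpace X} {T : X → X}
    (hT : Measurable T) {δ : ℕ → X → ι} (hδ : ∀ t, Measurable[m, ⊤] (δ t)) (r : ℕ) :
    Measurable[m, ⊤] (schedName T δ r) := by
  refine measurable_top_of_fiber fun c => ?_
  have : schedName T δ r ⁻¹' {c} = ⋂ t : Fin r, T^[t] ⁻¹' (δ t ⁻¹' {c t}) := by
    ext x; simp [schedName, funext_iff]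
  rw [this]
  exact MeasurableSet.iInter fun t => hT.iterate _ (hδ _ MeasurableSpace.measurableSet_top)

lemma schedInfo_succ {X ι : Type*} [MeasurableSpace X] (μ : Measure X) (T : X → X)
    (δ : ℕ → X → ι) (K r : ℕ) (x : X) : schedInfo μ T δ K (r + 1) x =
      schedInfo μ T (fun t => δ (t + 1)) K r (T x) + clipInfo μ T (δ 0) K x := by
  rw [schedInfo, Finset.sum_range_succ']
  rfl

lemma measurable_schedInfo {X ι : Type*} {m m0 : MeasurableSpace X} {μ : Measure[m0] X}
    {T : X → X} (hT : Measurable[m, m] T) {δ : ℕ → X → ι} {K : ℕ}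
    (hδ : ∀ t, Measurable[m] (@clipInfo X ι m0 μ T (δ t) K)) (r : ℕ) :
    Measurable[m] (@schedInfo X ι m0 μ T δ K r) :=
  Finset.measurable_sum _ fun t _ => (hδ t).comp (hT.iterate t)

/-- The measure of the schedule cell of `x` compared with its predicted size. -/
noncomputable def schedRatio {X ι : Type*} [MeasurableSpace X] (μ : Measure X) (T : X → X)
    (δ : ℕ → X → ι) (K r : ℕ) (x : X) : ℝ :=
  μ.real (schedName T δ r ⁻¹' {schedName T δ r x}) * Real.exp (schedInfo μ T δ K r x)

lemma schedRatio_nonneg {X ι : Type*} [MeasurableSpace X] (μ : Measure X) (T : X → X)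
    (δ : ℕ → X → ι) (K r : ℕ) (x : X) : 0 ≤ schedRatio μ T δ K r x :=
  mul_nonneg measureReal_nonneg (Real.exp_pos _).le

lemma schedRatio_le {X ι : Type*} [MeasurableSpace X] (μ : Measure X) [IsProbabilityMeasure μ]
    (T : X → X) (δ : ℕ → X → ι) (K r : ℕ) (x : X) :
    schedRatio μ T δ K r x ≤ Real.exp (r * K) := by
  refine (mul_le_of_le_one_left (Real.exp_pos _).le measureReal_le_one).trans ?_
  exact Real.exp_le_exp.2 (schedInfo_le μ T δ K r x)

lemma measurable_schedRatio {X ι : Type*} [MeasurableSpace X] [Fintype ι] {μ : Measure X}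
    {T : X → X} (hT : Measurable T) {δ : ℕ → X → ι} (hδ : ∀ t e, MeasurableSet (δ t ⁻¹' {e}))
    (K r : ℕ) : Measurable (schedRatio μ T δ K r) := by
  refine Measurable.mul ?_ (Real.measurable_exp.comp
    (measurable_schedInfo hT (fun t => measurable_clipInfo hT (hδ t) K) r))
  exact (measurable_from_top (f := fun c => μ.real (schedName T δ r ⁻¹' {c}))).comp
    (measurable_schedName hT (fun t => measurable_top_of_fiber (hδ t)) r)

lemma integral_schedRatio_le_one {X ι : Type*} [MeasurableSpace X] [Fintype ι] {μ : Measure X}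
    [IsProbabilityMeasure μ] {T : X → X} (hT : MeasurePreserving T μ μ) {δ : ℕ → X → ι}
    (hδ : ∀ t e, MeasurableSet (δ t ⁻¹' {e})) (hanti : Antitone fun t => futureAlg T (δ t))
    (K r : ℕ) : ∫ x, schedRatio μ T δ K r x ∂μ ≤ 1 := by
  induction r generalizing δ with
  | zero =>
    refine (integral_mono_of_nonneg (ae_of_all _ (schedRatio_nonneg μ T δ K 0))
      (integrable_const 1) (ae_of_all _ fun x => ?_)).trans (by simp)
    simpa using schedRatio_le μ T δ K 0 x
  | succ r ih =>
    set δ' : ℕ → X → ι := fun t => δ (t + 1) with hδ'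
    have ih' := ih (δ := δ') (fun t => hδ (t + 1)) (fun a b hab => hanti (by simpa using hab))
    have hTm : Measurable[futureAlg T (δ 0), futureAlg T (δ 0)] T :=
      measurable_futureAlg_self T (δ 0)
    have hN : Measurable[futureAlg T (δ 0), ⊤] (schedName T δ' r) :=
      measurable_schedName hTm (fun t => (measurable_label_futureAlg T (δ' t)).mono
        (hanti (Nat.zero_le _)) le_rfl) r
    have hI : Measurable[futureAlg T (δ 0)] (schedInfo μ T δ' K r) :=
      measurable_schedInfo hTm (fun t => (measurable_clipInfo_futureAlg T (δ' t) K).mono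
        (hanti (Nat.zero_le _)) le_rfl) r
    have hle : (futureAlg T (δ 0)).comap T ≤ ‹MeasurableSpace X› :=
      comap_futureAlg_le hT.measurable (hδ 0)
    have hcell : ∀ c, MeasurableSet (schedName T δ' r ⁻¹' {c}) := fun c =>
      futureAlg_le hT.measurable (hδ 0) _ (hN MeasurableSpace.measurableSet_top)
    -- the part of the new ratio that depends on the strict future only
    set V : ι → X → ℝ := fun e x =>
      μ.real (δ 0 ⁻¹' {e} ∩ T ⁻¹' (schedName T δ' r ⁻¹' {schedName T δ' r (T x)})) *
        Real.exp (schedInfo μ T δ' K r (T x)) with hV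
    have hV0 : ∀ e x, 0 ≤ V e x := fun e x => mul_nonneg measureReal_nonneg (Real.exp_pos _).le
    have hVb : ∀ e x, V e x ≤ Real.exp (r * K) := fun e x =>
      (mul_le_of_le_one_left (Real.exp_pos _).le measureReal_le_one).trans
        (Real.exp_le_exp.2 (schedInfo_le μ T δ' K r _))
    have hVm : ∀ e, Measurable[(futureAlg T (δ 0)).comap T] (V e) := fun e => by
      have hTc : Measurable[(futureAlg T (δ 0)).comap T, futureAlg T (δ 0)] T := comap_measurable T
      refine Measurable.mul ?_ (Real.measurable_exp.comp (hI.comp hTc))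
      exact (measurable_from_top (f := fun c => μ.real (δ 0 ⁻¹' {e} ∩
        T ⁻¹' (schedName T δ' r ⁻¹' {c})))).comp (hN.comp hTc)
    set Z : ι → X → ℝ := fun e x => V e x / clipP μ T (δ 0) K e x with hZ
    have hZm : ∀ e, Measurable[(futureAlg T (δ 0)).comap T] (Z e) := fun e =>
      (hVm e).div (measurable_clipP μ T (δ 0) K e)
    have hZb : ∀ e x, |Z e x| ≤ Real.exp (r * K) / Real.exp (-K) := fun e x => by
      rw [abs_of_nonneg (div_nonneg (hV0 e x) (clipP_pos μ T (δ 0) K e x).le)]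
      exact div_le_div₀ (Real.exp_pos _).le (hVb e x) (Real.exp_pos _)
        (clipP_mem_Icc μ T (δ 0) K e x).1
    have hdec : ∀ x, schedRatio μ T δ K (r + 1) x =
        ∑ e, (δ 0 ⁻¹' {e}).indicator (fun _ => (1 : ℝ)) x * Z e x := by
      intro x
      have h1 : schedRatio μ T δ K (r + 1) x = Z (δ 0 x) x := by
        have : schedName T δ (r + 1) ⁻¹' {schedName T δ (r + 1) x} =
            δ 0 ⁻¹' {δ 0 x} ∩ T ⁻¹' (schedName T δ' r ⁻¹' {schedName T δ' r (T x)}) := by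
          ext y; exact schedName_succ_fiber T δ x y
        rw [schedRatio, this, schedInfo_succ, Real.exp_add, clipInfo, Real.exp_neg,
          Real.exp_log (clipP_pos _ _ _ _ _ _)]
        simp only [hZ, hV, div_eq_mul_inv, mul_assoc]
        rfl
      rw [h1, comp_eq_sum_indicator (δ 0) Z]
      refine Finset.sum_congr rfl fun e _ => ?_
      by_cases hx : x ∈ δ 0 ⁻¹' {e} <;> simp [hx]
    have hZi : ∀ e, Integrable (fun x => (δ 0 ⁻¹' {e}).indicator (fun _ => (1 : ℝ)) x * Z e x) μ :=
      fun e => ((integrable_const (1 : ℝ)).indicator (hδ 0 e)).mul_bdd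
        ((hZm e).mono hle le_rfl).aestronglyMeasurable (ae_of_all _ (hZb e))
    have hVi : ∀ e, Integrable (V e) μ := fun e =>
      .of_bound ((hVm e).mono hle le_rfl).aestronglyMeasurable (Real.exp (r * K))
        (ae_of_all _ fun x => by rw [Real.norm_eq_abs, abs_of_nonneg (hV0 e x)]; exact hVb e x)
    have hstep : ∀ e, ∫ x, (δ 0 ⁻¹' {e}).indicator (fun _ => (1 : ℝ)) x * Z e x ∂μ ≤
        ∫ x, V e x ∂μ := by
      intro e
      rw [integral_condExp_mul hle (hδ 0 e) (hZm e) (hZb e)]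
      have hmem := condExp_indicator_mem_Icc (μ := μ) hle (hδ 0 e)
      refine integral_mono_of_nonneg ?_ (hVi e) ?_
      · filter_upwards [hmem] with x hx
        exact mul_nonneg hx.1 (div_nonneg (hV0 e x) (clipP_pos μ T (δ 0) K e x).le)
      · filter_upwards [hmem] with x hx
        have hc := clipP_pos μ T (δ 0) K e x
        simp only [hZ]
        rw [mul_div_assoc', div_le_iff₀ hc, mul_comm]
        refine mul_le_mul_of_nonneg_left ?_ (hV0 e x)
        exact (le_min le_rfl hx.2).trans (le_max_left _ _)
    have hsum : ∀ x, ∑ e, V e x = schedRatio μ T δ' K r (T x) := by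
      intro x
      simp only [hV]
      rw [← Finset.sum_mul, schedRatio]
      congr 1
      rw [← hT.measureReal_preimage (hcell _).nullMeasurableSet, ← measureReal_biUnion_finset]
      · congr 1
        ext y; simp
      · intro p _ q _ hpq
        refine disjoint_left.2 fun y hy hy' => hpq ?_
        rw [← hy.1, ← hy'.1]
      · exact fun e _ => (hδ 0 e).inter (hT.measurable (hcell _))
    calc ∫ x, schedRatio μ T δ K (r + 1) x ∂μ
        = ∑ e, ∫ x, (δ 0 ⁻¹' {e}).indicator (fun _ => (1 : ℝ)) x * Z e x ∂μ := by
          simp_rw [hdec]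
          exact integral_finsetSum _ fun e _ => hZi e
      _ ≤ ∑ e, ∫ x, V e x ∂μ := Finset.sum_le_sum fun e _ => hstep e
      _ = ∫ x, schedRatio μ T δ' K r (T x) ∂μ := by
          rw [← integral_finsetSum _ fun e _ => hVi e]
          simp_rw [hsum]
      _ = ∫ x, schedRatio μ T δ' K r x ∂μ := by
          have hmeas := measurable_schedRatio (μ := μ) hT.measurable (fun t => hδ (t + 1)) K r
          have := integral_map (μ := μ) (f := schedRatio μ T δ' K r) hT.measurable.aemeasurable
            hmeas.aestronglyMeasurable
          rw [← this, hT.map_eq]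
      _ ≤ 1 := ih'

/-- Along any sequence of schedules, cells are eventually not much larger than predicted. -/
lemma ae_eventually_cell_le {X ι : Type*} [MeasurableSpace X] [Fintype ι] {μ : Measure X}
    [IsProbabilityMeasure μ] {T : X → X} (hT : MeasurePreserving T μ μ) {δ : ℕ → ℕ → X → ι}
    (hδ : ∀ n t e, MeasurableSet (δ n t ⁻¹' {e}))
    (hanti : ∀ n, Antitone fun t => futureAlg T (δ n t)) (K : ℕ) (r : ℕ → ℕ) {κ : ℝ}
    (hκ : 0 < κ) :
    ∀ᵐ x ∂μ, ∀ᶠ n : ℕ in atTop,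
      μ.real (schedName T (δ n) (r n) ⁻¹' {schedName T (δ n) (r n) x}) ≤
        Real.exp (κ * n - schedInfo μ T (δ n) K (r n) x) := by
  have hbound : ∀ n : ℕ, μ {x | Real.exp (κ * n) ≤ schedRatio μ T (δ n) K (r n) x} ≤
      ENNReal.ofReal (Real.exp (-κ) ^ n) := by
    intro n
    have hm := measurable_schedRatio (μ := μ) hT.measurable (hδ n) K (r n)
    have hint : Integrable (schedRatio μ T (δ n) K (r n)) μ :=
      .of_bound hm.aestronglyMeasurable (Real.exp (r n * K)) (ae_of_all _ fun x => by
        rw [Real.norm_eq_abs, abs_of_nonneg (schedRatio_nonneg _ _ _ _ _ _)]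
        exact schedRatio_le _ _ _ _ _ _)
    have h1 := mul_meas_ge_le_integral_of_nonneg
      (ae_of_all μ (schedRatio_nonneg μ T (δ n) K (r n))) hint (Real.exp (κ * n))
    have h2 := h1.trans (integral_schedRatio_le_one hT (hδ n) (hanti n) K (r n))
    rw [← ofReal_measureReal]
    refine ENNReal.ofReal_le_ofReal ?_
    rw [← Real.exp_nat_mul, mul_neg, Real.exp_neg, ← one_div, le_div_iff₀ (Real.exp_pos _),
      mul_comm, mul_comm (n : ℝ)]
    exact h2
  have hsum : ∑' n : ℕ, μ {x | Real.exp (κ * n) ≤ schedRatio μ T (δ n) K (r n) x} ≠ ⊤ := by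
    refine ne_top_of_le_ne_top ?_ (ENNReal.tsum_le_tsum hbound)
    rw [← ENNReal.ofReal_tsum_of_nonneg (fun n => by positivity)]
    · exact ENNReal.ofReal_ne_top
    · exact summable_geometric_of_lt_one (Real.exp_pos _).le (Real.exp_lt_one_iff.2 (by linarith))
  filter_upwards [ae_eventually_notMem hsum] with x hx
  filter_upwards [hx] with n hn
  have : schedRatio μ T (δ n) K (r n) x < Real.exp (κ * n) := not_le.1 hn
  rw [Real.exp_sub, le_div_iff₀ (Real.exp_pos _)]
  exact this.le

end Schedule

section GoodSet

lemma cw_le_cw_sub {k : ℕ} {a : Fin k → ℝ} (ha : ∀ i, 0 ≤ a i) {i j : Fin k} (h : j < i) :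
    cw a j ≤ cw a i - a i := by
  have : cw a i = ∑ l ∈ Finset.Iio i, a l + a i := by
    rw [cw, ← Finset.Iio_insert, Finset.sum_insert (by simp), add_comm]
  rw [this, add_sub_cancel_right]
  refine Finset.sum_le_sum_of_subset_of_nonneg (fun l hl => ?_) fun l _ _ => ha l
  simp only [Finset.mem_Iic, Finset.mem_Iio] at *
  exact hl.trans_lt h

lemma le_cw {k : ℕ} {a : Fin k → ℝ} (ha : ∀ i, 0 ≤ a i) (i : Fin k) : a i ≤ cw a i :=
  Finset.single_le_sum (f := a) (fun l _ => ha l) (by simp)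

lemma cw_nonneg {k : ℕ} {a : Fin k → ℝ} (ha : ∀ i, 0 ≤ a i) (i : Fin k) : 0 ≤ cw a i :=
  (ha i).trans (le_cw ha i)

lemma cw_mono {k : ℕ} {a : Fin k → ℝ} (ha : ∀ i, 0 ≤ a i) : Monotone (cw a) := by
  intro i j hij
  exact Finset.sum_le_sum_of_subset_of_nonneg (Finset.Iic_subset_Iic.2 hij) fun l _ _ => ha l

/-- The time `⌈(a_1 + … + a_i) n⌉` during which the `i`-th coordinate is observed. -/
noncomputable def wLen {k : ℕ} (a : Fin k → ℝ) (n : ℕ) (i : Fin k) : ℕ := ⌈cw a i * (n : ℝ)⌉₊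

lemma wLen_mono {k : ℕ} {a : Fin k → ℝ} (ha : ∀ i, 0 ≤ a i) (n : ℕ) : Monotone (wLen a n) :=
  fun _ _ h => Nat.ceil_mono (mul_le_mul_of_nonneg_right (cw_mono ha h) n.cast_nonneg)

/-- The labels `c j` for those `j` which satisfy `P`. -/
def maskLabel {J X : Type*} {ι : J → Type*} (c : ∀ j, X → ι j) (P : J → Prop) [DecidablePred P]
    (x : X) (j : J) : Option (ι j) :=
  if P j then some (c j x) else none

lemma measurableSet_maskLabel_fiber {J X : Type*} [Finite J] {ι : J → Type*} [∀ j, Finite (ι j)]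
    [MeasurableSpace X] {c : ∀ j, X → ι j} (hc : ∀ j e, MeasurableSet (c j ⁻¹' {e}))
    (P : J → Prop) [DecidablePred P] (e : ∀ j, Option (ι j)) :
    MeasurableSet (maskLabel c P ⁻¹' {e}) := by
  have h : ∀ q : ∀ j, ι j, MeasurableSet ((fun x j => c j x) ⁻¹' {q}) := fun q => by
    have : (fun x j => c j x) ⁻¹' {q} = ⋂ j, c j ⁻¹' {q j} := by ext x; simp [funext_iff]
    rw [this]
    exact MeasurableSet.iInter fun j => hc j _
  exact measurable_top_of_fiber h (t := {q | (fun j => if P j then some (q j) else none) = e})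
    MeasurableSpace.measurableSet_top

lemma futureAlg_comp_le {X ι κ : Type*} (T : X → X) (d : X → ι) (π : ι → κ) :
    futureAlg T (π ∘ d) ≤ futureAlg T d := by
  refine iSup_le fun n => ?_
  have : itin T (π ∘ d) n = (fun c t => π (c t)) ∘ itin T d n := rfl
  rw [this, ← MeasurableSpace.comap_comp]
  exact (MeasurableSpace.comap_mono le_top).trans (comap_itin_le_futureAlg T d n)

lemma futureAlg_maskLabel_mono {J X : Type*} {ι : J → Type*} (T : X → X) (c : ∀ j, X → ι j)
    {P Q : J → Prop} [DecidablePred P] [DecidablePred Q] (hPQ : ∀ j, P j → Q j) :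
    futureAlg T (maskLabel c P) ≤ futureAlg T (maskLabel c Q) := by
  have : maskLabel c P = (fun q j => if P j then q j else none) ∘ maskLabel c Q := by
    ext x j : 2
    by_cases h : P j
    · simp [maskLabel, h, hPQ j h]
    · simp [maskLabel, h]
  rw [this]
  exact futureAlg_comp_le T _ _

/-- The points with the same weighted name of order `n` as `x`. -/
def wCell {k : ℕ} {X : Type*} {ι : Fin k → Type*} (T : X → X) (c : ∀ j, X → ι j) (a : Fin k → ℝ)
    (n : ℕ) (x : X) : Set X :=
  {y | ∀ i, ∀ t < wLen a n i, c i (T^[t] y) = c i (T^[t] x)}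

lemma wCell_eq_schedName_fiber {k : ℕ} {X : Type*} {ι : Fin k → Type*} (T : X → X)
    (c : ∀ j, X → ι j) (a : Fin k → ℝ) (n : ℕ) (x : X) {r : ℕ} (hr : ∀ i, wLen a n i ≤ r) :
    schedName T (fun t => maskLabel c (fun j => t < wLen a n j)) r ⁻¹'
      {schedName T (fun t => maskLabel c (fun j => t < wLen a n j)) r x} = wCell T c a n x := by
  ext y
  simp only [mem_preimage, mem_singleton_iff, wCell, mem_ofPred_eq]
  constructor
  · intro h i t ht
    have := congrFun (congrFun h ⟨t, ht.trans_le (hr i)⟩) i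
    simpa [schedName, maskLabel, ht] using this
  · intro h
    ext t i : 2
    by_cases ht : (t : ℕ) < wLen a n i
    · simp [schedName, maskLabel, ht, h i t ht]
    · simp [schedName, maskLabel, ht]

lemma sum_birk_sub_le_schedInfo {k : ℕ} {X : Type*} [MeasurableSpace X] {ι : Fin k → Type*}
    (μ : Measure X) (T : X → X) (c : ∀ j, X → ι j) {a : Fin k → ℝ} (ha : ∀ i, 0 ≤ a i)
    (K n : ℕ) (x : X) {r : ℕ} (hr : ∀ i, wLen a n i ≤ r) :
    ∑ i, (birk T (clipInfo μ T (maskLabel c (i ≤ ·)) K) ⌈cw a i * (n : ℝ)⌉₊ x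
        - birk T (clipInfo μ T (maskLabel c (i ≤ ·)) K) ⌈(cw a i - a i) * (n : ℝ)⌉₊ x) ≤
      schedInfo μ T (fun t => maskLabel c (fun j => t < wLen a n j)) K r x := by
  have hlow : ∀ i, ⌈(cw a i - a i) * (n : ℝ)⌉₊ ≤ wLen a n i := fun i =>
    Nat.ceil_mono (mul_le_mul_of_nonneg_right (by linarith [ha i]) n.cast_nonneg)
  have hblock : ∀ i, birk T (clipInfo μ T (maskLabel c (i ≤ ·)) K) ⌈cw a i * (n : ℝ)⌉₊ x
        - birk T (clipInfo μ T (maskLabel c (i ≤ ·)) K) ⌈(cw a i - a i) * (n : ℝ)⌉₊ x =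
      ∑ t ∈ Finset.Ico ⌈(cw a i - a i) * (n : ℝ)⌉₊ (wLen a n i),
        clipInfo μ T (maskLabel c (fun j => t < wLen a n j)) K (T^[t] x) := by
    intro i
    rw [birk, birk, ← wLen, ← Finset.sum_Ico_eq_sub _ (hlow i)]
    refine Finset.sum_congr rfl fun t ht => ?_
    rw [Finset.mem_Ico] at ht
    have : maskLabel c (fun j => t < wLen a n j) = maskLabel c (i ≤ ·) := by
      ext x j : 2
      have : t < wLen a n j ↔ i ≤ j := by
        refine ⟨fun h => ?_, fun h => ht.2.trans_le (wLen_mono ha n h)⟩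
        by_contra! hji
        exact absurd ht.1 (not_le.2 (h.trans_le (Nat.ceil_mono
          (mul_le_mul_of_nonneg_right (cw_le_cw_sub ha hji) n.cast_nonneg))))
      simp [maskLabel, this]
    rw [this]
  simp_rw [hblock]
  rw [← Finset.sum_biUnion, schedInfo]
  · refine Finset.sum_le_sum_of_subset_of_nonneg ?_ fun t _ _ => (clipInfo_mem_Icc μ T _ K _).1
    intro t ht
    simp only [Finset.mem_biUnion, Finset.mem_univ, true_and, Finset.mem_Ico] at ht
    obtain ⟨i, hi⟩ := ht
    exact Finset.mem_range.2 (hi.2.trans_le (hr i))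
  · intro i _ j _ hij
    wlog h : i < j generalizing i j
    · exact (this (Finset.mem_coe.2 (Finset.mem_univ j)) (Finset.mem_coe.2 (Finset.mem_univ i))
        hij.symm (lt_of_le_of_ne (not_lt.1 h) hij.symm)).symm
    · refine Finset.disjoint_left.2 fun t hti htj => ?_
      rw [Finset.mem_Ico] at hti htj
      exact absurd htj.1 (not_le.2 (hti.2.trans_le (Nat.ceil_mono
        (mul_le_mul_of_nonneg_right (cw_le_cw_sub ha h) n.cast_nonneg))))

lemma tendsto_comp_ceil_mul_div {u : ℕ → ℝ} {l c : ℝ} (h0 : u 0 = 0) (hc : 0 ≤ c)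
    (hu : Tendsto (fun n : ℕ => u n / n) atTop (𝓝 l)) :
    Tendsto (fun n : ℕ => u ⌈c * (n : ℝ)⌉₊ / n) atTop (𝓝 (c * l)) := by
  rcases hc.eq_or_lt with rfl | hc
  · simp [h0]
  have h1 : Tendsto (fun n : ℕ => c * (n : ℝ)) atTop atTop :=
    tendsto_natCast_atTop_atTop.const_mul_atTop hc
  have h2 : Tendsto (fun n : ℕ => ⌈c * (n : ℝ)⌉₊) atTop atTop := tendsto_nat_ceil_atTop.comp h1
  have h3 : Tendsto (fun n : ℕ => (⌈c * (n : ℝ)⌉₊ : ℝ) / n) atTop (𝓝 c) :=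
    (tendsto_nat_ceil_mul_div_atTop hc.le).comp tendsto_natCast_atTop_atTop
  refine (h3.mul (hu.comp h2)).congr' ?_
  filter_upwards [h2.eventually_gt_atTop 0] with n hn
  have : (⌈c * (n : ℝ)⌉₊ : ℝ) ≠ 0 := by exact_mod_cast hn.ne'
  simp only [Function.comp]
  field_simp

lemma tendsto_weighted_sum_div {k : ℕ} [NeZero k] {a : Fin k → ℝ} (ha0 : 0 < a 0)
    (ha : ∀ i, 0 ≤ a i) {u v : Fin k → ℕ → ℝ} {w : ℕ → ℝ} {g q : Fin k → ℝ} {f : ℝ} (ρ : ℝ)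
    (hu0 : ∀ i, u i 0 = 0) (hv0 : ∀ i, v i 0 = 0) (hw0 : w 0 = 0)
    (hu : ∀ i, Tendsto (fun n : ℕ => u i n / n) atTop (𝓝 (g i)))
    (hv : ∀ i, Tendsto (fun n : ℕ => v i n / n) atTop (𝓝 (q i)))
    (hw : Tendsto (fun n : ℕ => w n / n) atTop (𝓝 f)) :
    Tendsto (fun n : ℕ => (∑ i, (u i ⌈cw a i * (n : ℝ)⌉₊ - u i ⌈(cw a i - a i) * (n : ℝ)⌉₊)
        + 1 / a 0 * w ⌈a 0 * (n : ℝ)⌉₊ - ρ * ∑ i, v i (wLen a n i)) / n) atTop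
      (𝓝 (∑ i, a i * g i + f - ρ * ∑ i, cw a i * q i)) := by
  have e1 : ∀ i, Tendsto (fun n : ℕ => u i ⌈cw a i * (n : ℝ)⌉₊ / n
      - u i ⌈(cw a i - a i) * (n : ℝ)⌉₊ / n) atTop
      (𝓝 (cw a i * g i - (cw a i - a i) * g i)) := fun i =>
    (tendsto_comp_ceil_mul_div (hu0 i) (cw_nonneg ha i) (hu i)).sub
      (tendsto_comp_ceil_mul_div (hu0 i) (by linarith [le_cw ha i]) (hu i))
  have e3 : ∀ i, Tendsto (fun n : ℕ => v i (wLen a n i) / n) atTop (𝓝 (cw a i * q i)) := fun i =>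
    tendsto_comp_ceil_mul_div (hv0 i) (cw_nonneg ha i) (hv i)
  have e4 := ((tendsto_finsetSum Finset.univ fun i _ => e1 i).add
    ((tendsto_comp_ceil_mul_div hw0 ha0.le hw).const_mul (1 / a 0))).sub
    ((tendsto_finsetSum Finset.univ fun i _ => e3 i).const_mul ρ)
  have e5 : ∑ i, (cw a i * g i - (cw a i - a i) * g i) + 1 / a 0 * (a 0 * f)
      - ρ * ∑ i, cw a i * q i = ∑ i, a i * g i + f - ρ * ∑ i, cw a i * q i := by
    congr 2
    · exact Finset.sum_congr rfl fun i _ => by ring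
    · field_simp
  rw [e5] at e4
  refine e4.congr fun n => ?_
  rw [sub_div, add_div, Finset.sum_div, mul_div_assoc, mul_div_assoc, Finset.sum_div]
  simp_rw [sub_div]

/-- A set of positive measure whose points have small weighted cells at all large orders, with an
extra gain of `exp (-ρ)` for each visit to the exceptional sets `Q i`. -/
lemma exists_good_set {k : ℕ} [NeZero k] {X : Type*} [MeasurableSpace X] {ι : Fin k → Type*}
    [∀ j, Fintype (ι j)] {μ : Measure X} [IsProbabilityMeasure μ] {T : X → X}
    (hT : MeasurePreserving T μ μ) {c : ∀ j, X → ι j} (hc : ∀ j e, MeasurableSet (c j ⁻¹' {e}))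
    {a : Fin k → ℝ} (ha0 : 0 < a 0) (ha : ∀ i, 0 ≤ a i) {f : X → ℝ} (hf : Measurable f) {B : ℝ}
    (hB : ∀ x, |f x| ≤ B) {Q : Fin k → Set X} (hQ : ∀ i, MeasurableSet (Q i)) (K : ℕ) (ρ s : ℝ)
    (hs : s < ∑ i, a i * ∫ x, clipInfo μ T (maskLabel c (i ≤ ·)) K x ∂μ + ∫ x, f x ∂μ
      - ρ * ∑ i, cw a i * μ.real (Q i)) :
    ∃ (N : ℕ) (E : Set X), μ E ≠ 0 ∧ ∀ n, N ≤ n → ∀ y ∈ E, μ.real (wCell T c a n y) ≤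
      Real.exp (-(s * n) + 1 / a 0 * birk T f ⌈a 0 * (n : ℝ)⌉₊ y
        - ρ * ∑ i, birk T ((Q i).indicator fun _ => (1 : ℝ)) (wLen a n i) y) := by
  obtain ⟨s', hs', hs''⟩ := exists_between hs
  set g : Fin k → X → ℝ := fun i => clipInfo μ T (maskLabel c (i ≤ ·)) K with hg
  have hmask := fun (P : Fin k → Prop) [DecidablePred P] =>
    measurableSet_maskLabel_fiber (P := P) hc
  have hgm : ∀ i, Measurable (g i) := fun i => measurable_clipInfo hT.measurable (hmask _) K
  choose G hGi hGint hGt using fun i => exists_ae_tendsto_birkhoffSum_div hT (hgm i) (B := K)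
    fun x => by
      have := clipInfo_mem_Icc μ T (maskLabel c (i ≤ ·)) K x
      exact abs_le.2 ⟨by linarith [this.1, this.2], this.2⟩
  obtain ⟨F, hFi, hFint, hFt⟩ := exists_ae_tendsto_birkhoffSum_div hT hf hB
  choose D hDi hDint hDt using fun i => exists_ae_tendsto_birkhoffSum_div hT
    ((measurable_const (a := (1 : ℝ))).indicator (hQ i)) (B := 1)
    fun x => by by_cases hx : x ∈ Q i <;> simp [hx]
  set H : X → ℝ := fun x => ∑ i, a i * G i x + F x - ρ * ∑ i, cw a i * D i x with hH
  have hHint : ∫ x, H x ∂μ = ∑ i, a i * ∫ x, g i x ∂μ + ∫ x, f x ∂μ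
      - ρ * ∑ i, cw a i * μ.real (Q i) := by
    have i1 : Integrable (fun x => ∑ i, a i * G i x) μ :=
      integrable_finsetSum _ fun i _ => (hGi i).const_mul _
    have i2 : Integrable (fun x => ∑ i, cw a i * D i x) μ :=
      integrable_finsetSum _ fun i _ => (hDi i).const_mul _
    simp only [hH]
    have i3 : Integrable (fun x => ∑ i, a i * G i x + F x) μ := i1.add hFi
    rw [integral_sub i3 (i2.const_mul ρ), integral_add i1 hFi, integral_const_mul,
      integral_finsetSum _ fun i _ => (hGi i).const_mul _,
      integral_finsetSum _ fun i _ => (hDi i).const_mul _]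
    simp_rw [integral_const_mul, hGint, hFint, hDint, integral_indicator_const _ (hQ _),
      smul_eq_mul, mul_one]
  have hpos : μ {x | s' < H x} ≠ 0 := by
    intro h0
    have hle : ∀ᵐ x ∂μ, H x ≤ s' := by
      rw [ae_iff]; simpa using h0
    have hHI : Integrable H μ :=
      ((integrable_finsetSum _ fun i _ => (hGi i).const_mul _).add hFi).sub
        ((integrable_finsetSum _ fun i _ => (hDi i).const_mul _).const_mul ρ)
    have := integral_mono_ae hHI (integrable_const s') hle
    rw [hHint] at this
    simp at this
    linarith
  set r : ℕ → ℕ := fun n => ∑ i, wLen a n i with hr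
  have hri : ∀ n i, wLen a n i ≤ r n := fun n i =>
    Finset.single_le_sum (f := wLen a n) (fun _ _ => Nat.zero_le _) (Finset.mem_univ i)
  have hcell := ae_eventually_cell_le hT (δ := fun n t => maskLabel c (fun j => t < wLen a n j))
    (fun n t => hmask _)
    (fun n t t' htt' => futureAlg_maskLabel_mono T c fun j hj => htt'.trans_lt hj) K r
    (sub_pos.2 hs')
  set E : ℕ → Set X := fun N => {y | ∀ n, N ≤ n → μ.real (wCell T c a n y) ≤
      Real.exp (-(s * n) + 1 / a 0 * birk T f ⌈a 0 * (n : ℝ)⌉₊ y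
        - ρ * ∑ i, birk T ((Q i).indicator fun _ => (1 : ℝ)) (wLen a n i) y)} with hE
  have hunion : μ ({x | s' < H x} \ ⋃ N, E N) = 0 := by
    have key : ∀ᵐ x ∂μ, s' < H x → x ∈ ⋃ N, E N := by
      filter_upwards [hcell, ae_all_iff.2 hGt, hFt, ae_all_iff.2 hDt] with x hx hGx hFx hDx hHx
      have hlim : Tendsto (fun n : ℕ => (∑ i, (birk T (g i) ⌈cw a i * (n : ℝ)⌉₊ x
            - birk T (g i) ⌈(cw a i - a i) * (n : ℝ)⌉₊ x)
          + 1 / a 0 * birk T f ⌈a 0 * (n : ℝ)⌉₊ x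
          - ρ * ∑ i, birk T ((Q i).indicator fun _ => (1 : ℝ)) (wLen a n i) x) / n) atTop
          (𝓝 (H x)) := by
        exact tendsto_weighted_sum_div ha0 ha (u := fun i n => birk T (g i) n x)
          (v := fun i n => birk T ((Q i).indicator fun _ => (1 : ℝ)) n x)
          (w := fun n => birk T f n x) ρ (fun i => by simp [birk]) (fun i => by simp [birk])
          (by simp [birk]) hGx hDx hFx
      obtain ⟨N, hN⟩ := eventually_atTop.1 (hx.and ((hlim.eventually (lt_mem_nhds hHx)).and
        (eventually_gt_atTop 0)))
      refine mem_iUnion.2 ⟨N, fun n hn => ?_⟩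
      obtain ⟨h1, h2, h3⟩ := hN n hn
      rw [wCell_eq_schedName_fiber T c a n x (hri n)] at h1
      have h4 := sum_birk_sub_le_schedInfo μ T c ha K n x (hri n)
      rw [lt_div_iff₀ (by exact_mod_cast h3)] at h2
      refine h1.trans (Real.exp_le_exp.2 ?_)
      linarith
    rw [ae_iff] at key
    convert key using 2
    ext x
    simp
  obtain ⟨N, hN⟩ : ∃ N, μ (E N) ≠ 0 := by
    by_contra! h
    exact hpos (measure_mono_null (subset_sdiff_union _ (⋃ N, E N))
      (measure_union_null hunion (measure_iUnion_null h)))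
  exact ⟨N, E N, hN, fun n hn y hy => hy n hn⟩

end GoodSet

section Covering

/-- The total weight of all option-valued words is a product over the positions. -/
lemma sum_prod_option {k : ℕ} {ι : Fin k → Type*} [∀ j, Fintype (ι j)] (L : Fin k → ℕ) (q : ℝ) :
    ∑ p : ∀ i, Fin (L i) → Option (ι i), ∏ i, ∏ t, (p i t).elim 1 (fun _ => q) =
      ∏ i, (1 + Fintype.card (ι i) * q) ^ L i := by
  classical
  have h := Finset.prod_univ_sum (fun i => (Finset.univ : Finset (Fin (L i) → Option (ι i))))
    fun i g => ∏ t, (g t).elim 1 fun _ => q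
  rw [Fintype.piFinset_univ] at h
  rw [← h]
  refine Finset.prod_congr rfl fun i _ => ?_
  have h := Finset.prod_univ_sum (fun _ : Fin (L i) => (Finset.univ : Finset (Option (ι i))))
    fun _ o => o.elim 1 fun _ => q
  rw [Fintype.piFinset_univ] at h
  rw [← h]
  simp [Fintype.sum_option]

/-- A set of small oscillation meets a good set in a set of small measure. -/
lemma measure_inter_le_of_separated {k : ℕ} {X : Type*} [MeasurableSpace X] {ι : Fin k → Type*}
    [∀ j, Fintype (ι j)] {μ : Measure X} [IsFiniteMeasure μ] {T : X → X} {c : ∀ j, X → ι j}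
    {a : Fin k → ℝ} {Q : Fin k → Set X} {A E : Set X} {n : ℕ} {ρ S : ℝ}
    (hA : ∀ i, ∀ t < wLen a n i, ∀ y ∈ A, ∀ z ∈ A, T^[t] y ∉ Q i → T^[t] z ∉ Q i →
      c i (T^[t] y) = c i (T^[t] z))
    (hE : ∀ y ∈ A ∩ E, μ.real (wCell T c a n y) ≤
      Real.exp (S - ρ * ∑ i, birk T ((Q i).indicator fun _ => (1 : ℝ)) (wLen a n i) y)) :
    μ (A ∩ E) ≤ ENNReal.ofReal (Real.exp S *
      ∏ i, (1 + Fintype.card (ι i) * Real.exp (-ρ)) ^ wLen a n i) := by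
  classical
  set pat : X → ∀ i, Fin (wLen a n i) → Option (ι i) := fun y i t =>
    if T^[t] y ∈ Q i then some (c i (T^[t] y)) else none with hpat
  set w : (∀ i, Fin (wLen a n i) → Option (ι i)) → ℝ := fun p =>
    ∏ i, ∏ t, (p i t).elim 1 (fun _ => Real.exp (-ρ)) with hw
  have hw0 : ∀ p, 0 ≤ w p := fun p => Finset.prod_nonneg fun i _ => Finset.prod_nonneg fun t _ => by
    cases p i t <;> simp [Real.exp_nonneg]
  have hweight : ∀ y, Real.exp (S - ρ * ∑ i, birk T ((Q i).indicator fun _ => (1 : ℝ))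
      (wLen a n i) y) = Real.exp S * w (pat y) := by
    intro y
    have h1 : S - ρ * ∑ i, birk T ((Q i).indicator fun _ => (1 : ℝ)) (wLen a n i) y =
        S + ∑ i, ∑ t : Fin (wLen a n i), -ρ * (Q i).indicator (fun _ => (1 : ℝ)) (T^[t] y) := by
      simp only [birk, Finset.mul_sum, sub_eq_add_neg, ← Finset.sum_neg_distrib, neg_mul]
      simp_rw [Finset.sum_range]
    rw [h1, Real.exp_add, Real.exp_sum]
    simp_rw [Real.exp_sum]
    congr 1
    refine Finset.prod_congr rfl fun i _ => Finset.prod_congr rfl fun t _ => ?_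
    by_cases h : T^[t] y ∈ Q i <;> simp [hpat, h]
  have hpiece : ∀ p, μ (A ∩ E ∩ pat ⁻¹' {p}) ≤ ENNReal.ofReal (Real.exp S * w p) := by
    intro p
    rcases (A ∩ E ∩ pat ⁻¹' {p}).eq_empty_or_nonempty with h | ⟨y, hy, hyp⟩
    · simp [h]
    have hyp' : pat y = p := hyp
    have hsub : A ∩ E ∩ pat ⁻¹' {p} ⊆ wCell T c a n y := by
      rintro z ⟨hz, hzp⟩ i t ht
      have hzy : pat z i ⟨t, ht⟩ = pat y i ⟨t, ht⟩ := by
        rw [hyp', show pat z = p from hzp]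
      simp only [hpat] at hzy
      by_cases h1 : T^[t] z ∈ Q i <;> by_cases h2 : T^[t] y ∈ Q i
      · simpa [h1, h2] using hzy
      · simp [h1, h2] at hzy
      · simp [h1, h2] at hzy
      · exact hA i t ht z hz.1 y hy.1 h1 h2
    refine (measure_mono hsub).trans ?_
    rw [← ofReal_measureReal (μ := μ) (s := wCell T c a n y), ← hyp', ← hweight]
    exact ENNReal.ofReal_le_ofReal (hE y hy)
  have hcov : A ∩ E = ⋃ p, A ∩ E ∩ pat ⁻¹' {p} := by ext x; simp
  rw [hcov]
  refine (measure_iUnion_le _).trans ?_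
  rw [tsum_fintype, ← sum_prod_option, Finset.mul_sum,
    ENNReal.ofReal_sum_of_nonneg fun p _ => mul_nonneg (Real.exp_pos _).le (hw0 p)]
  exact Finset.sum_le_sum fun p _ => hpiece p

lemma abs_birk_le {X : Type*} {T : X → X} {f : X → ℝ} {B : ℝ} (hB : ∀ x, |f x| ≤ B) (n : ℕ)
    (x : X) : |birk T f n x| ≤ n * B := by
  refine (Finset.abs_sum_le_sum_abs _ _).trans ?_
  refine (Finset.sum_le_card_nsmul _ _ B fun t _ => hB _).trans ?_
  simp

lemma prod_one_add_pow_le {k : ℕ} {a : Fin k → ℝ} (ha : ∀ i, 0 ≤ a i) (n : ℕ) {m : Fin k → ℕ}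
    {M : ℕ} (hm : ∀ i, m i ≤ M) {q : ℝ} (hq : 0 ≤ q) :
    ∏ i, (1 + m i * q) ^ wLen a n i ≤ Real.exp (M * q * (∑ i, cw a i) * n + M * q * k) := by
  have h1 : ∀ i, (1 + m i * q) ^ wLen a n i ≤ Real.exp (M * q * (cw a i * n + 1)) := by
    intro i
    have h2 : 1 + m i * q ≤ Real.exp (M * q) := by
      have : (m i : ℝ) * q ≤ M * q := mul_le_mul_of_nonneg_right (by exact_mod_cast hm i) hq
      linarith [Real.add_one_le_exp (M * q)]
    refine (pow_le_pow_left₀ (by positivity) h2 _).trans ?_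
    rw [← Real.exp_nat_mul, mul_comm]
    refine Real.exp_le_exp.2 (mul_le_mul_of_nonneg_left ?_ (by positivity))
    exact (Nat.ceil_lt_add_one (mul_nonneg (cw_nonneg ha i) n.cast_nonneg)).le
  refine (Finset.prod_le_prod (fun i _ => by positivity) fun i _ => h1 i).trans ?_
  rw [← Real.exp_sum, ← Finset.mul_sum, Finset.sum_add_distrib, ← Finset.sum_mul]
  simp [mul_add, mul_assoc]

lemma lamBowen_ne_zero_of_good_set {k : ℕ} [NeZero k] {X : Fin k → Type*} [∀ i, MetricSpace (X i)]
    {X1 : Type*} [MeasurableSpace X1] {ι : Fin k → Type*} [∀ j, Fintype (ι j)] {μ : Measure X1}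
    [IsFiniteMeasure μ] {T1 : X1 → X1} {T : ∀ i, X i → X i} {τ : ∀ i, X1 → X i}
    {c : ∀ j, X1 → ι j} {a : Fin k → ℝ} (ha0 : 0 < a 0) (ha : ∀ i, 0 ≤ a i) {f : X1 → ℝ} {B : ℝ}
    (hB : ∀ x, |f x| ≤ B) {Q : Fin k → Set X1} {E : Set X1} (hE0 : μ E ≠ 0) {N M : ℕ}
    {s ρ ε : ℝ} (hM : ∀ i, Fintype.card (ι i) ≤ M)
    (hE : ∀ n, N ≤ n → ∀ y ∈ E, μ.real (wCell T1 c a n y) ≤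
      Real.exp (-((s + M * Real.exp (-ρ) * ∑ i, cw a i) * n)
        + 1 / a 0 * birk T1 f ⌈a 0 * (n : ℝ)⌉₊ y
        - ρ * ∑ i, birk T1 ((Q i).indicator fun _ => (1 : ℝ)) (wLen a n i) y))
    (hsep : ∀ n, ∀ x, ∀ y ∈ wBowen T τ a n x ε, ∀ z ∈ wBowen T τ a n x ε, ∀ i, ∀ t < wLen a n i,
      T1^[t] y ∉ Q i → T1^[t] z ∉ Q i → c i (T1^[t] y) = c i (T1^[t] z)) :
    lamBowen T1 T τ a f s ε univ ≠ 0 := by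
  set C : ℝ := Real.exp (M * Real.exp (-ρ) * k)
  have hpiece : ∀ n, N ≤ n → ∀ (A : Set X1) (x : X1), A ⊆ wBowen T τ a n x ε →
      μ (A ∩ E) ≤ ENNReal.ofReal C * pterm T1 f (a 0) s n A := by
    intro n hn A x hAx
    have hbdd : BddAbove (birk T1 f ⌈a 0 * (n : ℝ)⌉₊ '' A) := by
      refine ⟨⌈a 0 * (n : ℝ)⌉₊ * B, ?_⟩
      rintro _ ⟨y, -, rfl⟩
      exact (le_abs_self _).trans (abs_birk_le hB _ y)
    refine (measure_inter_le_of_separated (c := c) (Q := Q) (n := n) (a := a) (ρ := ρ)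
      (S := -((s + M * Real.exp (-ρ) * ∑ i, cw a i) * n)
        + 1 / a 0 * sSup (birk T1 f ⌈a 0 * (n : ℝ)⌉₊ '' A))
      (fun i t ht y hy z hz => hsep n x y (hAx hy) z (hAx hz) i t ht) ?_).trans ?_
    · intro y hy
      refine (hE n hn y hy.2).trans (Real.exp_le_exp.2 ?_)
      have := le_csSup hbdd (mem_image_of_mem _ hy.1)
      gcongr
    · rw [pterm, ← ENNReal.ofReal_mul (Real.exp_pos _).le]
      refine ENNReal.ofReal_le_ofReal ?_
      refine (mul_le_mul_of_nonneg_left (prod_one_add_pow_le ha n hM (Real.exp_pos (-ρ)).le)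
        (Real.exp_pos _).le).trans (le_of_eq ?_)
      rw [← Real.exp_add, ← Real.exp_add]
      congr 1
      ring
  have hlow : μ E / ENNReal.ofReal C ≤ lamBowenN T1 T τ a f s ε N univ := by
    refine le_iInf₂ fun D hD => le_iInf₂ fun hD' hcov => ?_
    rw [ENNReal.div_le_iff' (by simpa using Real.exp_pos _) ENNReal.ofReal_ne_top,
      ← ENNReal.tsum_mul_left]
    have := hD.to_subtype
    have hsub : E ⊆ ⋃ p : D, p.1.2 ∩ E := fun y hy => by
      obtain ⟨p, hp, hyp⟩ := mem_iUnion₂.1 (hcov (mem_univ y))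
      exact mem_iUnion.2 ⟨⟨p, hp⟩, hyp, hy⟩
    refine (measure_mono hsub).trans ((measure_iUnion_le _).trans ?_)
    refine ENNReal.tsum_le_tsum fun p => ?_
    obtain ⟨h1, -, x, hx⟩ := hD' p.1 p.2
    exact hpiece _ h1 _ x hx
  intro h0
  have h1 : lamBowenN T1 T τ a f s ε N univ ≤ 0 :=
    (le_iSup (fun N => lamBowenN T1 T τ a f s ε N univ) N).trans h0.le
  have h2 := hlow.trans h1
  rw [nonpos_iff_eq_zero, ENNReal.div_eq_zero_iff] at h2
  exact h2.elim hE0 ENNReal.ofReal_ne_top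

end Covering

section Partition

lemma IsPart.exists_label {X ι : Type*} [MeasurableSpace X] {β : ι → Set X} (hβ : IsPart β) :
    ∃ l : X → ι, ∀ e, l ⁻¹' {e} = β e := by
  choose l hl using fun x => mem_iUnion.1 (hβ.2.2.symm ▸ mem_univ x : x ∈ ⋃ i, β i)
  refine ⟨l, fun e => Subset.antisymm ?_ fun x hx => ?_⟩
  · rintro x rfl
    exact hl x
  · by_contra h
    exact disjoint_left.1 (hβ.2.1 _ _ h) (hl x) hx

lemma negMulLog_sum_le {κ : Type*} (s : Finset κ) {p : κ → ℝ} (hp : ∀ c ∈ s, 0 ≤ p c) :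
    Real.negMulLog (∑ c ∈ s, p c) ≤ ∑ c ∈ s, Real.negMulLog (p c) := by
  simp only [Real.negMulLog, neg_mul, Finset.sum_mul, Finset.sum_neg_distrib]
  refine neg_le_neg (Finset.sum_le_sum fun c hc => ?_)
  rcases (hp c hc).eq_or_lt with h | h
  · simp [← h]
  · exact mul_le_mul_of_nonneg_left (Real.log_le_log h (Finset.single_le_sum hp hc)) h.le

lemma itinEnt_comp_le {X ι κ : Type*} [MeasurableSpace X] [Fintype ι] [Fintype κ] {μ : Measure X}
    [IsFiniteMeasure μ] {T : X → X} (hT : Measurable T) {d : X → ι}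
    (hd : ∀ e, MeasurableSet (d ⁻¹' {e})) (π : ι → κ) (n : ℕ) :
    itinEnt μ T (π ∘ d) n ≤ itinEnt μ T d n := by
  classical
  set p : (Fin n → ι) → ℝ := fun c => μ.real (itin T d n ⁻¹' {c})
  have h : ∀ b : Fin n → κ, μ.real (itin T (π ∘ d) n ⁻¹' {b}) =
      ∑ c with (fun t => π (c t)) = b, p c := by
    intro b
    rw [← measureReal_biUnion_finset]
    · congr 1
      ext x
      simp only [itin, mem_preimage, mem_singleton_iff, funext_iff, Function.comp_apply,
        Finset.mem_filter, Finset.mem_univ, true_and, mem_iUnion, exists_prop]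
      exact ⟨fun h => ⟨_, h, fun _ => rfl⟩, fun ⟨i, h, h'⟩ t => by rw [h' t]; exact h t⟩
    · intro c _ c' _ hcc'
      refine disjoint_left.2 fun x hx hx' => hcc' ?_
      exact Eq.trans (Eq.symm hx) hx'
    · exact fun c _ => measurableSet_itin_fiber hT hd n c
  calc itinEnt μ T (π ∘ d) n
      ≤ ∑ b : Fin n → κ, ∑ c with (fun t => π (c t)) = b, Real.negMulLog (p c) := by
        refine Finset.sum_le_sum fun b _ => ?_
        rw [h b]
        exact negMulLog_sum_le _ fun c _ => measureReal_nonneg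
    _ = itinEnt μ T d n := Finset.sum_fiberwise _ _ _

lemma entH_map_dynJoin {X Y ι : Type*} [MeasurableSpace X] [MeasurableSpace Y] [Fintype ι]
    {μ : Measure X} {T : X → X} {S : Y → Y} {τ : X → Y} (hS : Measurable S) (hτ : Measurable τ)
    (hsemi : τ ∘ T = S ∘ τ) {β : ι → Set Y} (hβ : IsPart β) {l : Y → ι}
    (hl : ∀ e, l ⁻¹' {e} = β e) (n : ℕ) :
    entH (μ.map τ) (dynJoin S β n) = itinEnt μ T (l ∘ τ) n := by
  refine Finset.sum_congr rfl fun c _ => ?_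
  have hm : MeasurableSet (dynJoin S β n c) :=
    MeasurableSet.iInter fun t => hS.iterate _ (hβ.1 _)
  rw [Measure.map_apply hτ hm, Measure.real]
  congr 3
  ext x
  have hiter : ∀ t, S^[t] (τ x) = τ (T^[t] x) := fun t =>
    ((Function.Semiconj.iterate_right (f := τ) (ga := T) (gb := S) (congrFun hsemi) t) x).symm
  simp [dynJoin, itin, funext_iff, hiter, ← hl]

lemma hPart_map_le {X Y ι κ : Type*} [MeasurableSpace X] [MeasurableSpace Y] [Fintype ι]
    [Fintype κ] {μ : Measure X} [IsProbabilityMeasure μ] {T : X → X}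
    (hT : MeasurePreserving T μ μ) {S : Y → Y} {τ : X → Y} (hS : Measurable S) (hτ : Measurable τ)
    (hsemi : τ ∘ T = S ∘ τ) {β : ι → Set Y} (hβ : IsPart β) {l : Y → ι}
    (hl : ∀ e, l ⁻¹' {e} = β e) {d : X → κ} (hd : ∀ e, MeasurableSet (d ⁻¹' {e})) {π : κ → ι}
    (hπ : l ∘ τ = π ∘ d) :
    hPart (μ.map τ) S β ≤ ((∑ e, ∫ x, Real.negMulLog (condP μ T d e x) ∂μ : ℝ) : EReal) := by
  have hlim := (continuous_coe_real_ereal.tendsto _).comp (tendsto_itinEnt_div hT hd)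
  rw [← hlim.liminf_eq]
  refine liminf_le_liminf (Eventually.of_forall fun n => ?_)
  refine EReal.coe_le_coe_iff.2 (div_le_div_of_nonneg_right ?_ n.cast_nonneg)
  rw [entH_map_dynJoin hS hτ hsemi hβ hl, hπ]
  exact itinEnt_comp_le hT.measurable hd π n

lemma hPart_nonneg {X ι : Type*} [MeasurableSpace X] [Fintype ι] (μ : Measure X)
    [IsProbabilityMeasure μ] (S : X → X) (β : ι → Set X) : 0 ≤ hPart μ S β := by
  refine le_liminf_of_le (by isBoundedDefault) (Eventually.of_forall fun n => ?_)
  refine EReal.coe_nonneg.2 (div_nonneg ?_ n.cast_nonneg)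
  exact Finset.sum_nonneg fun c _ => Real.negMulLog_nonneg measureReal_nonneg measureReal_le_one

/-- Away from a set of small measure, the pieces of a finite partition are uniformly separated. -/
lemma exists_small_eventually_separated {Y ι : Type*} [MetricSpace Y] [CompactSpace Y]
    [MeasurableSpace Y] [BorelSpace Y] [Fintype ι] (ν : Measure Y) [IsFiniteMeasure ν]
    {β : ι → Set Y} (hβ : IsPart β) {l : Y → ι} (hl : ∀ e, l ⁻¹' {e} = β e) {η : ℝ} (hη : 0 < η) :
    ∃ Q : Set Y, MeasurableSet Q ∧ ν.real Q ≤ η ∧ ∀ᶠ ε in 𝓝[>] (0 : ℝ), ∀ x y z,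
      dist x y < ε → dist x z < ε → y ∉ Q → z ∉ Q → l y = l z := by
  set η' : ℝ := η / (Fintype.card ι + 1) with hη'
  have hη'0 : 0 < η' := by positivity
  choose C hCβ hCc hCν using fun e => (hβ.1 e).exists_isClosed_sdiff_lt (μ := ν)
    (measure_ne_top _ _) (ENNReal.ofReal_pos.2 hη'0).ne'
  refine ⟨⋃ e, β e \ C e, MeasurableSet.iUnion fun e => (hβ.1 e).diff (hCc e).measurableSet,
    ?_, ?_⟩
  · have h1 : ∀ e, ν.real (β e \ C e) ≤ η' := fun e =>
      ENNReal.toReal_le_of_le_ofReal hη'0.le (hCν e).le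
    refine (measureReal_iUnion_fintype_le _).trans ((Finset.sum_le_sum fun e _ => h1 e).trans ?_)
    rw [Finset.sum_const, nsmul_eq_mul, Finset.card_univ, hη', mul_div_assoc',
      div_le_iff₀ (by positivity)]
    nlinarith
  · have hsep : ∀ e e', e ≠ e' → ∀ᶠ ε in 𝓝[>] (0 : ℝ),
        Disjoint (Metric.thickening ε (C e)) (Metric.thickening ε (C e')) := by
      intro e e' hee'
      obtain ⟨δ, hδ, hdis⟩ := ((hβ.2.1 e e' hee').mono (hCβ e) (hCβ e')).exists_thickenings
        (hCc e).isCompact (hCc e')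
      filter_upwards [Ioo_mem_nhdsGT hδ] with ε hε
      exact hdis.mono (Metric.thickening_mono hε.2.le _) (Metric.thickening_mono hε.2.le _)
    have hmem : ∀ y, y ∉ ⋃ e, β e \ C e → y ∈ C (l y) := by
      intro y hy
      by_contra h
      refine hy (mem_iUnion.2 ⟨l y, ?_, h⟩)
      rw [← hl]; rfl
    filter_upwards [eventually_all.2 fun e => eventually_all.2 fun e' =>
      eventually_imp_distrib_left.2 (hsep e e')]
      with ε hε x y z hy hz hyQ hzQ
    by_contra hne
    exact disjoint_left.1 (hε _ _ hne) (Metric.mem_thickening_iff.2 ⟨y, hmem y hyQ, hy⟩)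
      (Metric.mem_thickening_iff.2 ⟨z, hmem z hzQ, hz⟩)

end Partition

section Pressure

lemma le_PBowenEps_of_forall_lt {k : ℕ} [NeZero k] {X : Fin k → Type*} [∀ i, MetricSpace (X i)]
    {X1 : Type*} [MeasurableSpace X1] {T1 : X1 → X1} {T : ∀ i, X i → X i} {τ : ∀ i, X1 → X i}
    {a : Fin k → ℝ} {f : X1 → ℝ} {Z : Set X1} {ε r : ℝ}
    (h : ∀ s < r, lamBowen T1 T τ a f s ε Z ≠ 0) : (r : EReal) ≤ PBowenEps T1 T τ a Z f ε := by
  refine le_sInf ?_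
  rintro _ ⟨s, hs, rfl⟩
  refine EReal.coe_le_coe_iff.2 (not_lt.1 fun hlt => h s hlt hs)

lemma coe_le_PBowen_of_lt_condP {k : ℕ} [NeZero k] {X : Fin k → Type*} [∀ i, MetricSpace (X i)]
    [∀ i, CompactSpace (X i)] [∀ i, MeasurableSpace (X i)] [∀ i, BorelSpace (X i)]
    {X1 : Type*} [MeasurableSpace X1] {μ : Measure X1} [IsProbabilityMeasure μ]
    {T1 : X1 → X1} (hT1 : MeasurePreserving T1 μ μ) {T : ∀ i, X i → X i} {τ : ∀ i, X1 → X i}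
    (hτ : ∀ i, Measurable (τ i)) (hτe : ∀ i, τ i ∘ T1 = T i ∘ τ i)
    {a : Fin k → ℝ} (ha0 : 0 < a 0) (ha : ∀ i, 0 ≤ a i) {f : X1 → ℝ} (hf : Measurable f)
    {B : ℝ} (hB : ∀ x, |f x| ≤ B) {ι : Fin k → Type*} [∀ j, Fintype (ι j)]
    {β : ∀ i, ι i → Set (X i)} (hβ : ∀ i, IsPart (β i)) {l : ∀ i, X i → ι i}
    (hl : ∀ i e, l i ⁻¹' {e} = β i e) {r : ℝ}
    (hr : r < ∑ i, a i * ∑ e, ∫ x, Real.negMulLog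
      (condP μ T1 (maskLabel (fun j x => l j (τ j x)) (i ≤ ·)) e x) ∂μ + ∫ x, f x ∂μ) :
    (r : EReal) ≤ PBowen T1 T τ a univ f := by
  set c : ∀ j, X1 → ι j := fun j x => l j (τ j x) with hc
  have hcm : ∀ j e, MeasurableSet (c j ⁻¹' {e}) := fun j e => by
    have := hτ j ((hβ j).1 e)
    rwa [← hl] at this
  have hlim : Tendsto (fun K : ℕ => ∑ i, a i * ∫ x, clipInfo μ T1 (maskLabel c (i ≤ ·)) K x ∂μ
      + ∫ x, f x ∂μ) atTop (𝓝 (∑ i, a i * ∑ e, ∫ x, Real.negMulLog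
      (condP μ T1 (maskLabel c (i ≤ ·)) e x) ∂μ + ∫ x, f x ∂μ)) :=
    (tendsto_finsetSum _ fun i _ => (tendsto_integral_clipInfo hT1
      (measurableSet_maskLabel_fiber hcm _)).const_mul _).add_const _
  obtain ⟨K, hK⟩ := (hlim.eventually (lt_mem_nhds hr)).exists
  set θ : ℝ := ∑ i, a i * ∫ x, clipInfo μ T1 (maskLabel c (i ≤ ·)) K x ∂μ + ∫ x, f x ∂μ - r
    with hθ
  have hθ0 : 0 < θ := sub_pos.2 hK
  set M : ℕ := ∑ i, Fintype.card (ι i)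
  have hM : ∀ i, Fintype.card (ι i) ≤ M := fun i =>
    Finset.single_le_sum (f := fun i => Fintype.card (ι i)) (fun _ _ => Nat.zero_le _)
      (Finset.mem_univ i)
  set W : ℝ := ∑ i, cw a i with hW
  have hW0 : 0 ≤ W := Finset.sum_nonneg fun i _ => cw_nonneg ha i
  obtain ⟨ρ, hρ, hρ0⟩ : ∃ ρ : ℝ, M * Real.exp (-ρ) * W < θ / 2 ∧ 0 ≤ ρ := by
    have h := (Real.tendsto_exp_neg_atTop_nhds_zero.const_mul (M : ℝ)).mul_const W
    rw [mul_zero, zero_mul] at h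
    exact ((h.eventually (gt_mem_nhds (half_pos hθ0))).and (eventually_ge_atTop 0)).exists
  set η : ℝ := θ / (2 * (ρ * W + 1)) with hη
  have hρW : 0 ≤ ρ * W := mul_nonneg hρ0 hW0
  have hη0 : 0 < η := by positivity
  choose Q hQm hQη hQsep using fun i =>
    exists_small_eventually_separated (μ.map (τ i)) (hβ i) (hl i) hη0
  obtain ⟨ε, hε, hε0⟩ := ((eventually_all.2 hQsep).and self_mem_nhdsWithin).exists
  have hQμ : ρ * ∑ i, cw a i * μ.real (τ i ⁻¹' Q i) ≤ θ / 2 := by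
    have h1 : ∀ i, μ.real (τ i ⁻¹' Q i) ≤ η := fun i => by
      rw [← map_measureReal_apply (hτ i) (hQm i)]
      exact hQη i
    have h2 : ∑ i, cw a i * μ.real (τ i ⁻¹' Q i) ≤ W * η := by
      rw [hW, Finset.sum_mul]
      exact Finset.sum_le_sum fun i _ => mul_le_mul_of_nonneg_left (h1 i) (cw_nonneg ha i)
    refine (mul_le_mul_of_nonneg_left h2 hρ0).trans ?_
    rw [hη, ← mul_assoc, mul_div_assoc', div_le_div_iff₀ (by positivity) two_pos]
    nlinarith
  refine le_trans (le_PBowenEps_of_forall_lt fun s hs => ?_)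
    (le_iSup (fun ε : {e : ℝ // 0 < e} => PBowenEps T1 T τ a univ f ε.1) ⟨ε, hε0⟩)
  obtain ⟨N, E, hE0, hE⟩ := exists_good_set hT1 hcm ha0 ha hf hB
    (fun i => hτ i (hQm i)) K ρ (s + M * Real.exp (-ρ) * W) (by linarith)
  refine lamBowen_ne_zero_of_good_set ha0 ha hB hE0 hM hE ?_
  intro n x y hy z hz i t ht hyQ hzQ
  have hiter : ∀ w, (T i)^[t] (τ i w) = τ i (T1^[t] w) := fun w =>
    ((Function.Semiconj.iterate_right (f := τ i) (ga := T1) (gb := T i) (congrFun (hτe i)) t)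
      w).symm
  have h1 := hy i t ht
  have h2 := hz i t ht
  simp only [hiter] at h1 h2
  exact hε i _ _ _ h1 h2 hyQ hzQ

lemma sum_hPart_add_integral_le_PBowen {k : ℕ} [NeZero k] {X : Fin k → Type*}
    [∀ i, MetricSpace (X i)] [∀ i, CompactSpace (X i)] [∀ i, MeasurableSpace (X i)]
    [∀ i, BorelSpace (X i)] {X1 : Type*} [MeasurableSpace X1] {μ : Measure X1}
    [IsProbabilityMeasure μ] {T1 : X1 → X1} (hT1 : MeasurePreserving T1 μ μ)
    {T : ∀ i, X i → X i} (hT : ∀ i, Measurable (T i)) {τ : ∀ i, X1 → X i}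
    (hτ : ∀ i, Measurable (τ i)) (hτe : ∀ i, τ i ∘ T1 = T i ∘ τ i)
    {a : Fin k → ℝ} (ha0 : 0 < a 0) (ha : ∀ i, 0 ≤ a i) {f : X1 → ℝ} (hf : Measurable f)
    {B : ℝ} (hB : ∀ x, |f x| ≤ B) {ι : Fin k → Type*} [∀ j, Fintype (ι j)]
    {β : ∀ i, ι i → Set (X i)} (hβ : ∀ i, IsPart (β i)) :
    ∑ i, ((a i : ℝ) : EReal) * hPart (μ.map (τ i)) (T i) (β i) + ((∫ x, f x ∂μ : ℝ) : EReal) ≤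
      PBowen T1 T τ a univ f := by
  choose l hl using fun i => (hβ i).exists_label
  obtain ⟨x0⟩ : Nonempty X1 := μ.nonempty_of_neZero
  set c : ∀ j, X1 → ι j := fun j x => l j (τ j x) with hc
  have hcm : ∀ j e, MeasurableSet (c j ⁻¹' {e}) := fun j e => by
    have := hτ j ((hβ j).1 e)
    rwa [← hl] at this
  have hent : ∀ i, hPart (μ.map (τ i)) (T i) (β i) ≤ ((∑ e, ∫ x, Real.negMulLog
      (condP μ T1 (maskLabel c (i ≤ ·)) e x) ∂μ : ℝ) : EReal) := fun i =>
    hPart_map_le hT1 (hT i) (hτ i) (hτe i) (hβ i) (hl i) (measurableSet_maskLabel_fiber hcm _)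
      (π := fun q => (q i).getD (c i x0)) (by ext x; simp [maskLabel, hc])
  have hsum : ∑ i, ((a i : ℝ) : EReal) * hPart (μ.map (τ i)) (T i) (β i) ≤
      ((∑ i, a i * ∑ e, ∫ x, Real.negMulLog
      (condP μ T1 (maskLabel c (i ≤ ·)) e x) ∂μ : ℝ) : EReal) := by
    refine le_of_le_of_eq ?_ (map_sum (⟨⟨Real.toEReal, EReal.coe_zero⟩, EReal.coe_add⟩ :
      ℝ →+ EReal) _ _).symm
    refine Finset.sum_le_sum fun i _ => ?_
    refine le_of_le_of_eq ?_ (EReal.coe_mul _ _).symm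
    exact mul_le_mul_of_nonneg_left (hent i) (EReal.coe_nonneg.2 (ha i))
  refine (add_le_add_left hsum _).trans ?_
  rw [← EReal.coe_add]
  refine EReal.ge_of_forall_gt_iff_ge.1 fun r hr => ?_
  exact coe_le_PBowen_of_lt_condP hT1 hτ hτe ha0 ha hf hB hβ hl (EReal.coe_lt_coe_iff.1 hr)

lemma tendsto_finsetSum_ereal {κ : Type*} (s : Finset κ) {u : κ → ℕ → EReal} {v : κ → EReal}
    (hu : ∀ i n, 0 ≤ u i n) (h : ∀ i, Tendsto (u i) atTop (𝓝 (v i))) :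
    Tendsto (fun n => ∑ i ∈ s, u i n) atTop (𝓝 (∑ i ∈ s, v i)) := by
  classical
  have hv : ∀ i, 0 ≤ v i := fun i => ge_of_tendsto' (h i) (hu i)
  induction s using Finset.induction_on with
  | empty => simp
  | insert i s hi ih =>
    simp_rw [Finset.sum_insert hi]
    have hs : 0 ≤ ∑ i ∈ s, v i := Finset.sum_nonneg fun i _ => hv i
    exact (EReal.continuousAt_add (p := (v i, ∑ i ∈ s, v i))
      (.inr (EReal.bot_lt_zero.trans_le hs).ne')
      (.inl (EReal.bot_lt_zero.trans_le (hv i)).ne')).tendsto.comp ((h i).prodMk_nhds ih)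

end Pressure

/-- (lower bound of the variational principle)
`P^𝐚(T₁, f) ≥ sup_{μ ∈ M(X₁,T₁)} (∑_i a_i h_{τ_{i-1}μ}(T_i) + ∫ f dμ)`. -/
theorem weighted_pressure_ge_sup
    {k : ℕ} [NeZero k]
    (X : Fin k → Type) [∀ i, MetricSpace (X i)] [∀ i, CompactSpace (X i)]
    [∀ i, MeasurableSpace (X i)] [∀ i, BorelSpace (X i)]
    (T : ∀ i, X i → X i) (hT : ∀ i, Continuous (T i))
    (τ : ∀ i, X 0 → X i) (hτ0 : τ 0 = id)
    (hτc : ∀ i, Continuous (τ i)) (hτs : ∀ i, Function.Surjective (τ i))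
    (hτe : ∀ i, τ i ∘ T 0 = T i ∘ τ i)
    (hchain : ∀ i j : Fin k, i ≤ j → ∃ p : X i → X j,
        Continuous p ∧ p ∘ T i = T j ∘ p ∧ p ∘ τ i = τ j)
    (a : Fin k → ℝ) (ha1 : 0 < a 0) (ha : ∀ i, 0 ≤ a i)
    (f : X 0 → ℝ) (hf : Continuous f) :
    (⨆ μ : {μ : Measure (X 0) // IsProbabilityMeasure μ ∧ μ.map (T 0) = μ},
        (∑ i : Fin k, ((a i : ℝ) : EReal) * hKS (μ.1.map (τ i)) (T i))
          + ((∫ x, f x ∂μ.1 : ℝ) : EReal))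
      ≤ PBowen (T 0) T τ a Set.univ f := by
  refine iSup_le fun ⟨μ, hμ, hμT⟩ => ?_
  have hT1 : MeasurePreserving (T 0) μ μ := ⟨(hT 0).measurable, hμT⟩
  obtain ⟨B, hB⟩ := isCompact_univ.exists_bound_of_continuousOn hf.continuousOn
  have hprob : ∀ i, IsProbabilityMeasure (μ.map (τ i)) := fun i =>
    Measure.isProbabilityMeasure_map (hτc i).aemeasurable
  have hseq : ∀ i, ∃ p : ℕ → Σ m : ℕ, {β : Fin m → Set (X i) // IsPart β},
      Tendsto (fun n => hPart (μ.map (τ i)) (T i) (p n).2.1) atTop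
        (𝓝 (hKS (μ.map (τ i)) (T i))) := by
    intro i
    have huniv : IsPart fun _ : Fin 1 => (univ : Set (X i)) :=
      ⟨fun _ => MeasurableSet.univ, fun i j h => absurd (Subsingleton.elim i j) h, iUnion_const _⟩
    obtain ⟨u, -, hu, hmem⟩ := exists_seq_tendsto_sSup
      (S := range fun p : Σ m : ℕ, {β : Fin m → Set (X i) // IsPart β} =>
        hPart (μ.map (τ i)) (T i) p.2.1) ⟨_, ⟨1, _, huniv⟩, rfl⟩ (OrderTop.bddAbove _)
    choose p hp using hmem
    refine ⟨p, ?_⟩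
    simp only [hp]
    exact hu
  choose p hp using hseq
  have hlim : Tendsto (fun n => ∑ i, ((a i : ℝ) : EReal) *
      hPart (μ.map (τ i)) (T i) (p i n).2.1) atTop
      (𝓝 (∑ i, ((a i : ℝ) : EReal) * hKS (μ.map (τ i)) (T i))) := by
    refine tendsto_finsetSum_ereal _
      (fun i n => mul_nonneg (EReal.coe_nonneg.2 (ha i)) (hPart_nonneg _ _ _)) fun i => ?_
    exact EReal.Tendsto.const_mul (hp i) (.inl (EReal.coe_ne_bot _)) (.inl (EReal.coe_ne_top _))
  have hlim' := (EReal.continuousAt_add (p := (_, ((∫ x, f x ∂μ : ℝ) : EReal)))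
    (.inr (EReal.coe_ne_bot _)) (.inr (EReal.coe_ne_top _))).tendsto.comp
    (hlim.prodMk_nhds tendsto_const_nhds)
  refine le_of_tendsto' hlim' fun n => ?_
  exact sum_hPart_add_integral_le_PBowen hT1 (fun i => (hT i).measurable)
    (fun i => (hτc i).measurable) hτe ha1 ha hf.measurable (fun x => hB x (mem_univ x))
    fun i => (p i n).2.2

end WTP
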